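/- Let (A, Q) be a relative n-Auslander–Gorenstein pair with pd_A Q ≤ d ≤ n − 2, id_A Q ≤ n − d, Ext^{i>0}_A(Q,Q) = 0, and d ≥ 2. Let Λ = End_A(Q)^op. Then there exists an exact sequence 0 → Q_{n−d} → ⋯ → Q_0 → ν_Λ Ω^d(Q) → 0 of right Λ-modules which remains exact under Hom_Λ(Q, −), with each Q_i ∈ add(Q_Λ). -/

import Mathlib

universe u
open MulOpposite

noncomputable section
namespace Paper

section RingDefs
variable (B : Type u) [Ring B]

/-- `X` belongs to `add Q`: it is a direct summand of a finite direct sum of copies of `Q`. -/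
def InAdd (Q X : ModuleCat.{u} B) : Prop :=
  ∃ (n : ℕ) (s : X →ₗ[B] (Fin n → Q)) (r : (Fin n → Q) →ₗ[B] X), r ∘ₗ s = LinearMap.id

/-- A superfluous (small) submodule. -/
def Superfluous {P : ModuleCat.{u} B} (N : Submodule B P) : Prop :=
  ∀ K : Submodule B P, K ⊔ N = ⊤ → K = ⊤

/-- An essential (large) submodule. -/
def Essential {P : ModuleCat.{u} B} (N : Submodule B P) : Prop :=
  ∀ K : Submodule B P, K ⊓ N = ⊥ → K = ⊥

/-- `p : P → X` is a projective cover. -/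
def IsProjCover {P X : ModuleCat.{u} B} (p : P →ₗ[B] X) : Prop :=
  Module.Projective B P ∧ Function.Surjective p ∧ Superfluous B (LinearMap.ker p)

/-- `ι : X → I` is an injective envelope. -/
def IsInjEnvelope {X I : ModuleCat.{u} B} (ι : X →ₗ[B] I) : Prop :=
  Module.Injective B I ∧ Function.Injective ι ∧ Essential B (LinearMap.range ι)

/-- The zero module. -/
def zeroMod : ModuleCat.{u} B := ModuleCat.of B PUnit

/-- An exact sequence `0 → P_m → ⋯ → P_1 → P_0 → X → 0` whose terms satisfy the
predicate `T` and which remains exact under `Hom(test, −)`. -/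
def ResLE (test : ModuleCat.{u} B) (T : ModuleCat.{u} B → Prop)
    (X : ModuleCat.{u} B) (m : ℕ) : Prop :=
  ∃ (P : ℕ → ModuleCat.{u} B) (d : ∀ j, P (j+1) →ₗ[B] P j) (aug : P 0 →ₗ[B] X),
    (∀ j, j ≤ m → T (P j)) ∧ (∀ j, m < j → Subsingleton (P j)) ∧
    Function.Surjective aug ∧ Function.Exact (d 0) aug ∧
    (∀ j, Function.Exact (d (j+1)) (d j)) ∧
    (∀ f : test →ₗ[B] X, ∃ h : test →ₗ[B] P 0, aug ∘ₗ h = f) ∧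
    (∀ f : test →ₗ[B] P 0, aug ∘ₗ f = 0 → ∃ h : test →ₗ[B] P 1, d 0 ∘ₗ h = f) ∧
    (∀ j, ∀ f : test →ₗ[B] P (j+1), d j ∘ₗ f = 0 →
      ∃ h : test →ₗ[B] P (j+2), d (j+1) ∘ₗ h = f)

/-- An exact sequence `0 → X → I_0 → ⋯ → I_m → 0` whose terms satisfy the predicate `T`
and which remains exact under `Hom(−, test)`. -/
def CoresLE (test : ModuleCat.{u} B) (T : ModuleCat.{u} B → Prop)
    (X : ModuleCat.{u} B) (m : ℕ) : Prop :=
  ∃ (M : ℕ → ModuleCat.{u} B) (ι : X →ₗ[B] M 0) (d : ∀ j, M j →ₗ[B] M (j+1)),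
    (∀ j, j ≤ m → T (M j)) ∧ (∀ j, m < j → Subsingleton (M j)) ∧
    Function.Injective ι ∧ Function.Exact ι (d 0) ∧
    (∀ j, Function.Exact (d j) (d (j+1))) ∧
    (∀ f : X →ₗ[B] test, ∃ h : M 0 →ₗ[B] test, h ∘ₗ ι = f) ∧
    (∀ f : M 0 →ₗ[B] test, f ∘ₗ ι = 0 → ∃ h : M 1 →ₗ[B] test, h ∘ₗ d 0 = f) ∧
    (∀ j, ∀ f : M (j+1) →ₗ[B] test, f ∘ₗ d j = 0 →
      ∃ h : M (j+2) →ₗ[B] test, h ∘ₗ d (j+1) = f)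

/-- Projective dimension at most `n`. -/
def pdLE (X : ModuleCat.{u} B) (n : ℕ) : Prop :=
  ResLE B (zeroMod B) (fun P => Module.Projective B P) X n

/-- Injective dimension at most `n`. -/
def idLE (X : ModuleCat.{u} B) (n : ℕ) : Prop :=
  CoresLE B (zeroMod B) (fun I => Module.Injective B I) X n

/-- Projective dimension equal to `n`. -/
def pdEq (X : ModuleCat.{u} B) (n : ℕ) : Prop :=
  pdLE B X n ∧ ∀ j, pdLE B X j → n ≤ j

/-- Injective dimension equal to `n`. -/
def idEq (X : ModuleCat.{u} B) (n : ℕ) : Prop :=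
  idLE B X n ∧ ∀ j, idLE B X j → n ≤ j

/-- Projective dimension as an element of `ℕ∞`. -/
def pdDim (X : ModuleCat.{u} B) : ℕ∞ :=
  sInf {c : ℕ∞ | ∃ n : ℕ, c = n ∧ pdLE B X n}

/-- Injective dimension as an element of `ℕ∞`. -/
def idDim (X : ModuleCat.{u} B) : ℕ∞ :=
  sInf {c : ℕ∞ | ∃ n : ℕ, c = n ∧ idLE B X n}

/-- Relative dominant dimension of `X` with respect to `Q` is at least `n`:
there is an exact sequence `0 → X → Q_1 → ⋯ → Q_n` with `Q_i ∈ add Q`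
remaining exact under `Hom(−, Q)`. -/
def domdimGE (Q X : ModuleCat.{u} B) (n : ℕ) : Prop :=
  n = 0 ∨ ∃ (M : ℕ → ModuleCat.{u} B) (ι : X →ₗ[B] M 0) (d : ∀ j, M j →ₗ[B] M (j+1)),
    (∀ j, j + 1 ≤ n → InAdd B Q (M j)) ∧
    Function.Injective ι ∧ (2 ≤ n → Function.Exact ι (d 0)) ∧
    (∀ j, j + 3 ≤ n → Function.Exact (d j) (d (j+1))) ∧
    (∀ f : X →ₗ[B] Q, ∃ h : M 0 →ₗ[B] Q, h ∘ₗ ι = f) ∧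
    (2 ≤ n → ∀ f : M 0 →ₗ[B] Q, f ∘ₗ ι = 0 → ∃ h : M 1 →ₗ[B] Q, h ∘ₗ d 0 = f) ∧
    (∀ j, j + 3 ≤ n → ∀ f : M (j+1) →ₗ[B] Q, f ∘ₗ d j = 0 →
      ∃ h : M (j+2) →ₗ[B] Q, h ∘ₗ d (j+1) = f)

/-- Relative codominant dimension of `X` with respect to `Q` is at least `n`. -/
def codomdimGE (Q X : ModuleCat.{u} B) (n : ℕ) : Prop :=
  n = 0 ∨ ∃ (M : ℕ → ModuleCat.{u} B) (aug : M 0 →ₗ[B] X) (d : ∀ j, M (j+1) →ₗ[B] M j),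
    (∀ j, j + 1 ≤ n → InAdd B Q (M j)) ∧
    Function.Surjective aug ∧ (2 ≤ n → Function.Exact (d 0) aug) ∧
    (∀ j, j + 3 ≤ n → Function.Exact (d (j+1)) (d j)) ∧
    (∀ f : Q →ₗ[B] X, ∃ h : Q →ₗ[B] M 0, aug ∘ₗ h = f) ∧
    (2 ≤ n → ∀ f : Q →ₗ[B] M 0, aug ∘ₗ f = 0 → ∃ h : Q →ₗ[B] M 1, d 0 ∘ₗ h = f) ∧
    (∀ j, j + 3 ≤ n → ∀ f : Q →ₗ[B] M (j+1), d j ∘ₗ f = 0 →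
      ∃ h : Q →ₗ[B] M (j+2), d (j+1) ∘ₗ h = f)

/-- Relative dominant dimension with respect to `Q`, as an element of `ℕ∞`. -/
def relDomDim (Q X : ModuleCat.{u} B) : ℕ∞ :=
  sSup {c : ℕ∞ | ∃ n : ℕ, c = n ∧ domdimGE B Q X n}

/-- Relative codominant dimension with respect to `Q`, as an element of `ℕ∞`. -/
def relCodomDim (Q X : ModuleCat.{u} B) : ℕ∞ :=
  sSup {c : ℕ∞ | ∃ n : ℕ, c = n ∧ codomdimGE B Q X n}

/-- A projective resolution. -/
structure ProjRes (X : ModuleCat.{u} B) where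
  P : ℕ → ModuleCat.{u} B
  d : ∀ j, P (j+1) →ₗ[B] P j
  aug : P 0 →ₗ[B] X
  proj : ∀ j, Module.Projective B (P j)
  augSurj : Function.Surjective aug
  exact0 : Function.Exact (d 0) aug
  exact : ∀ j, Function.Exact (d (j+1)) (d j)

/-- Vanishing of `Ext^i(X, Y)`, expressed via projective resolutions. -/
def ExtVanish (X Y : ModuleCat.{u} B) : ℕ → Prop
  | 0 => Subsingleton (X →ₗ[B] Y)
  | (i+1) => ∀ R : ProjRes B X, ∀ f : R.P (i+1) →ₗ[B] Y,
      f ∘ₗ R.d (i+1) = 0 → ∃ g : R.P i →ₗ[B] Y, f = g ∘ₗ R.d i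

/-- `Q` is self-orthogonal: `Ext^i(Q, Q) = 0` for all `i > 0`. -/
def SelfOrth (Q : ModuleCat.{u} B) : Prop := ∀ i, 1 ≤ i → ExtVanish B Q Q i

/-- `Z` is a (first, minimal) syzygy of `X`. -/
def IsSyzygyOf (X Z : ModuleCat.{u} B) : Prop :=
  ∃ (P : ModuleCat.{u} B) (p : P →ₗ[B] X), IsProjCover B p ∧
    Nonempty (Z ≃ₗ[B] LinearMap.ker p)

/-- `Z` is an `n`-th syzygy `Ω^n X`. -/
def IsOmegaOf : ℕ → ModuleCat.{u} B → ModuleCat.{u} B → Prop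
  | 0, X, Z => Nonempty (Z ≃ₗ[B] X)
  | (n+1), X, Z => ∃ Y, IsSyzygyOf B X Y ∧ IsOmegaOf n Y Z

/-- `Z` is a (first, minimal) cosyzygy of `X`. -/
def IsCosyzygyOf (X Z : ModuleCat.{u} B) : Prop :=
  ∃ (I : ModuleCat.{u} B) (ι : X →ₗ[B] I), IsInjEnvelope B ι ∧
    Nonempty (Z ≃ₗ[B] (I ⧸ LinearMap.range ι))

/-- `Z` is an `n`-th cosyzygy `Ω^{-n} X`. -/
def IsOmegaInvOf : ℕ → ModuleCat.{u} B → ModuleCat.{u} B → Prop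
  | 0, X, Z => Nonempty (Z ≃ₗ[B] X)
  | (n+1), X, Z => ∃ Y, IsCosyzygyOf B X Y ∧ IsOmegaInvOf n Y Z

/-- Precomposition with `g`, as a map of right `B`-modules `Hom(P₀,B) → Hom(P₁,B)`. -/
def lprecomp {P1 P0 : ModuleCat.{u} B} (g : P1 →ₗ[B] P0) :
    (P0 →ₗ[B] B) →ₗ[Bᵐᵒᵖ] (P1 →ₗ[B] B) where
  toFun h := h ∘ₗ g
  map_add' _ _ := rfl
  map_smul' _ _ := rfl

/-- `T` is a transpose `Tr X` (computed from a minimal projective presentation). -/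
def IsTransposeOf (X : ModuleCat.{u} B) (T : ModuleCat.{u} Bᵐᵒᵖ) : Prop :=
  ∃ (P1 P0 : ModuleCat.{u} B) (g : P1 →ₗ[B] P0) (p : P0 →ₗ[B] X),
    IsProjCover B p ∧ Module.Projective B P1 ∧ Function.Exact g p ∧
    Superfluous B (LinearMap.ker g) ∧
    Nonempty (T ≃ₗ[Bᵐᵒᵖ] ((P1 →ₗ[B] B) ⧸ LinearMap.range (lprecomp B g)))

/-- The canonical ring homomorphism `B →+* Bᵐᵒᵖᵐᵒᵖ`. -/
def opOpHom : B →+* Bᵐᵒᵖᵐᵒᵖ where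
  toFun b := op (op b)
  map_one' := rfl
  map_mul' _ _ := rfl
  map_zero' := rfl
  map_add' _ _ := rfl


/-- An `F_Mo`-projective resolution: terms in `add(B ⊕ Mo)`, exact, and remaining
exact under `Hom(Mo, −)`. -/
structure FProjRes (Mo X : ModuleCat.{u} B) where
  P : ℕ → ModuleCat.{u} B
  d : ∀ j, P (j+1) →ₗ[B] P j
  aug : P 0 →ₗ[B] X
  mem : ∀ j, InAdd B (ModuleCat.of B (B × Mo)) (P j)
  augSurj : Function.Surjective aug
  exact0 : Function.Exact (d 0) aug
  exact : ∀ j, Function.Exact (d (j+1)) (d j)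
  lift0 : ∀ f : Mo →ₗ[B] X, ∃ h : Mo →ₗ[B] P 0, aug ∘ₗ h = f
  lift1 : ∀ f : Mo →ₗ[B] P 0, aug ∘ₗ f = 0 → ∃ h : Mo →ₗ[B] P 1, d 0 ∘ₗ h = f
  lift : ∀ j, ∀ f : Mo →ₗ[B] P (j+1), d j ∘ₗ f = 0 →
    ∃ h : Mo →ₗ[B] P (j+2), d (j+1) ∘ₗ h = f

/-- Vanishing of the relative extension group `Ext^i_{F_Mo}(X, Y)`, computed via
`F_Mo`-projective resolutions. -/
def FExtVanish (Mo X Y : ModuleCat.{u} B) : ℕ → Prop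
  | 0 => True
  | (i+1) => ∀ R : FProjRes B Mo X, ∀ f : R.P (i+1) →ₗ[B] Y,
      f ∘ₗ R.d (i+1) = 0 → ∃ g : R.P i →ₗ[B] Y, f = g ∘ₗ R.d i

end RingDefs

section Duality
variable (k : Type u) [Field k] (B : Type u) [Ring B] [Algebra k B]

noncomputable instance kmod (X : ModuleCat.{u} B) : Module k X :=
  Module.compHom X (algebraMap k B)

instance kmodSMulComm (X : ModuleCat.{u} B) : SMulCommClass B k X :=
  ⟨fun b c x => by
    show b • ((algebraMap k B c) • x) = (algebraMap k B c) • (b • x)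
    rw [← mul_smul, ← mul_smul, Algebra.commutes]⟩

instance kmodTower (X : ModuleCat.{u} B) : IsScalarTower k B X :=
  ⟨fun c b x => by
    show (c • b) • x = (algebraMap k B c) • (b • x)
    rw [Algebra.smul_def, mul_smul]⟩

noncomputable instance dualModL (X : ModuleCat.{u} B) : Module Bᵐᵒᵖ (X →ₗ[k] k) where
  smul b φ := φ ∘ₗ (DistribMulAction.toLinearMap k X b.unop)
  one_smul φ := by
    ext x
    show φ ((1 : Bᵐᵒᵖ).unop • x) = φ x
    rw [unop_one, one_smul]
  mul_smul b c φ := by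
    ext x
    show φ ((b * c).unop • x) = φ (c.unop • b.unop • x)
    rw [unop_mul, mul_smul]
  smul_zero b := rfl
  smul_add b φ ψ := rfl
  add_smul b c φ := by
    ext x
    show φ ((b + c).unop • x) = φ (b.unop • x) + φ (c.unop • x)
    rw [unop_add, add_smul, map_add]
  zero_smul φ := by
    ext x
    show φ ((0 : Bᵐᵒᵖ).unop • x) = 0
    rw [unop_zero, zero_smul, map_zero]

/-- The standard duality `D = Hom_k(−, k)`, sending a left `B`-module to a right
`B`-module. -/
def Dop (X : ModuleCat.{u} B) : ModuleCat.{u} Bᵐᵒᵖ :=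
  ModuleCat.of Bᵐᵒᵖ (X →ₗ[k] k)

noncomputable instance dualModR (Y : ModuleCat.{u} Bᵐᵒᵖ) : Module B (Y →ₗ[k] k) where
  smul b φ := φ ∘ₗ (DistribMulAction.toLinearMap k Y (op b))
  one_smul φ := by
    ext x
    show φ ((op (1:B)) • x) = φ x
    rw [op_one, one_smul]
  mul_smul b c φ := by
    ext x
    show φ ((op (b * c)) • x) = φ ((op c) • (op b) • x)
    rw [op_mul, mul_smul]
  smul_zero b := rfl
  smul_add b φ ψ := rfl
  add_smul b c φ := by
    ext x
    show φ ((op (b + c)) • x) = φ ((op b) • x) + φ ((op c) • x)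
    rw [op_add, add_smul, map_add]
  zero_smul φ := by
    ext x
    show φ ((op (0 : B)) • x) = 0
    rw [op_zero, zero_smul, map_zero]

/-- The standard duality `D = Hom_k(−, k)`, sending a right `B`-module to a left
`B`-module. -/
def Dunop (Y : ModuleCat.{u} Bᵐᵒᵖ) : ModuleCat.{u} B :=
  ModuleCat.of B (Y →ₗ[k] k)

/-- `D(B_B)`, the standard injective cogenerator of `B`-Mod. -/
def Dcogen : ModuleCat.{u} B := Dunop k B (ModuleCat.of Bᵐᵒᵖ B)

/-- `T ≅ τ X = D Tr X`, the Auslander–Reiten translate. -/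
def IsTauOf (X T : ModuleCat.{u} B) : Prop :=
  ∃ Tr : ModuleCat.{u} Bᵐᵒᵖ, IsTransposeOf B X Tr ∧ Nonempty (T ≃ₗ[B] Dunop k B Tr)

/-- `T ≅ τ_n X = τ Ω^{n-1} X`. -/
def IsTauN (n : ℕ) (X T : ModuleCat.{u} B) : Prop :=
  ∃ Z, IsOmegaOf B (n-1) X Z ∧ IsTauOf k B Z T

/-- `T ≅ τ⁻ X = Tr D X`, the inverse Auslander–Reiten translate. -/
def IsTauInvOf (X T : ModuleCat.{u} B) : Prop :=
  ∃ Tr2 : ModuleCat.{u} Bᵐᵒᵖᵐᵒᵖ, IsTransposeOf Bᵐᵒᵖ (Dop k B X) Tr2 ∧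
    Nonempty (T ≃ₗ[B] ((ModuleCat.restrictScalars (opOpHom B)).obj Tr2))

/-- `T ≅ τ⁻_n X = τ⁻ Ω^{-(n-1)} X`. -/
def IsTauInvN (n : ℕ) (X T : ModuleCat.{u} B) : Prop :=
  ∃ Z, IsOmegaInvOf B (n-1) X Z ∧ IsTauInvOf k B Z T

/-- The Nakayama functor `ν = D Hom_B(−, B)` (on objects). -/
def nu (X : ModuleCat.{u} B) : ModuleCat.{u} B :=
  Dunop k B (ModuleCat.of Bᵐᵒᵖ (X →ₗ[B] B))

/-- The inverse Nakayama functor `ν⁻ = Hom_B(D(−), B)` (on objects). -/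
def nuInv (X : ModuleCat.{u} B) : ModuleCat.{u} B :=
  (ModuleCat.restrictScalars (opOpHom B)).obj
    (ModuleCat.of Bᵐᵒᵖᵐᵒᵖ ((Dop k B X) →ₗ[Bᵐᵒᵖ] Bᵐᵒᵖ))

/-- Relative `add Q`-dimension of `X` is at most `m`. -/
def RelAddDimLE (Q X : ModuleCat.{u} B) (m : ℕ) : Prop :=
  ResLE B Q (InAdd B Q) X m

/-- Relative `add Q`-codimension of `X` is at most `m`. -/
def RelAddCodimLE (Q X : ModuleCat.{u} B) (m : ℕ) : Prop :=
  CoresLE B Q (InAdd B Q) X m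

/-- `Q` is an `l`-quasi-generator (without minimality of `l`). -/
def QuasiGenLE (Q : ModuleCat.{u} B) (l : ℕ) : Prop :=
  CoresLE B Q (InAdd B Q) (ModuleCat.of B B) l

/-- `Q` is an `l`-quasi-generator: `l` is minimal. -/
def IsQuasiGen (Q : ModuleCat.{u} B) (l : ℕ) : Prop :=
  QuasiGenLE B Q l ∧ ∀ j, QuasiGenLE B Q j → l ≤ j

/-- `Q` is an `m`-quasi-cogenerator (without minimality of `m`). -/
def QuasiCogenLE (Q : ModuleCat.{u} B) (m : ℕ) : Prop :=
  ResLE B Q (InAdd B Q) (Dcogen k B) m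

/-- `Q` is an `m`-quasi-cogenerator: `m` is minimal. -/
def IsQuasiCogen (Q : ModuleCat.{u} B) (m : ℕ) : Prop :=
  QuasiCogenLE k B Q m ∧ ∀ j, QuasiCogenLE k B Q j → m ≤ j

/-- `(B, Q)` is a relative `n`-Auslander–Gorenstein pair. -/
def IsRelAGPair (Q : ModuleCat.{u} B) (n : ℕ) : Prop :=
  idLE B (ModuleCat.of B B) n ∧ idLE Bᵐᵒᵖ (ModuleCat.of Bᵐᵒᵖ Bᵐᵒᵖ) n ∧
  SelfOrth B Q ∧ domdimGE B Q (ModuleCat.of B B) n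

/-- `Q` is an `(n, m, l)`-quasi-precluster tilting module. -/
def IsQPCT (Q : ModuleCat.{u} B) (n m l : ℕ) : Prop :=
  (∀ i, 1 ≤ i → i ≤ n - 2 → ExtVanish B Q Q i) ∧
  IsQuasiGen B Q l ∧
  IsQuasiCogen k B Q m ∧
  (∃ T, IsTauN k B (n - m - 1) Q T ∧ RelAddDimLE B Q T m) ∧
  (∃ T, IsTauInvN k B (n - l - 1) Q T ∧ RelAddCodimLE B Q T l)

/-- Precomposition with `g`, as a `k`-linear map between Hom spaces. -/
def pcompk {X Y Z : ModuleCat.{u} B} (g : X →ₗ[B] Y) :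
    (Y →ₗ[B] Z) →ₗ[k] (X →ₗ[B] Z) where
  toFun h := h ∘ₗ g
  map_add' _ _ := rfl
  map_smul' _ _ := rfl


/-- `I` is an injective object for the exact structure `F_Mo`: it lies in
`add(DB ⊕ τ Mo)`. -/
def IsFInj (Mo I : ModuleCat.{u} B) : Prop :=
  ∃ T, IsTauOf k B Mo T ∧ InAdd B (ModuleCat.of B ((Dcogen k B) × T)) I

/-- `T` is an `F_Mo`-cotilting object: finite relative injective dimension, no relative
self-extensions, and the relative injectives `DB ⊕ τ Mo` admit a finite `F_Mo`-exact
resolution by objects of `add T`. -/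
def FCotilting (Mo T : ModuleCat.{u} B) : Prop :=
  (∃ r, CoresLE B Mo (IsFInj k B Mo) T r) ∧
  (∀ i, 1 ≤ i → FExtVanish B Mo T T i) ∧
  (∃ τM, IsTauOf k B Mo τM ∧
    ∃ r, ResLE B Mo (InAdd B T) (ModuleCat.of B ((Dcogen k B) × τM)) r)

end Duality

section EndStuff
variable (A : Type u) [Ring A] (Q : ModuleCat.{u} A)

/-- The canonical ring homomorphism `A → End_{End_A(Q)}(Q)`. -/
def toEndE : A →+* Module.End (Module.End A Q) Q where
  toFun a :=
    { toFun := fun q => a • q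
      map_add' := fun x y => smul_add a x y
      map_smul' := fun e q => (e.map_smul a q).symm }
  map_one' := by ext q; exact one_smul A q
  map_mul' x y := by ext q; exact mul_smul x y q
  map_zero' := by ext q; exact zero_smul A q
  map_add' x y := by ext q; exact add_smul x y q

/-- `Hom_A(Q, X)` as a left module over `End_A(Q)ᵐᵒᵖ` (i.e. a left `Λ`-module) by
precomposition. -/
noncomputable instance homPrecompMod (X : ModuleCat.{u} A) :
    Module (Module.End A Q)ᵐᵒᵖ (Q →ₗ[A] X) where
  smul e f := f ∘ₗ e.unop
  one_smul f := by ext q; rfl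
  mul_smul e e' f := by ext q; rfl
  smul_zero e := rfl
  smul_add e f g := rfl
  add_smul e e' f := by ext q; exact map_add f _ _
  zero_smul f := by ext q; exact map_zero f

/-- The actions of `A` and of `End_A(Q)` on `Q` commute. -/
instance endSMulComm : SMulCommClass (Module.End A Q) A Q :=
  ⟨fun e a q => e.map_smul a q⟩

instance endSMulComm' : SMulCommClass A (Module.End A Q) Q :=
  ⟨fun a e q => (e.map_smul a q).symm⟩

end EndStuff

end Paper
end

namespace P10
open Paper CategoryTheory CategoryTheory.Abelian

section ExtTools
variable (B : Type) [Ring B]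

/-- Vanishing of the Mathlib `Ext` group. -/
def EV (X Y : Type) [AddCommGroup X] [Module B X] [AddCommGroup Y] [Module B Y] (i : ℕ) : Prop :=
  Subsingleton (Ext.{0} (ModuleCat.of B X) (ModuleCat.of B Y) i)

variable {B}
variable {X Y Z W : Type} [AddCommGroup X] [Module B X] [AddCommGroup Y] [Module B Y]
  [AddCommGroup Z] [Module B Z] [AddCommGroup W] [Module B W]

/-- the short complex attached to an exact pair -/
noncomputable abbrev sc (f : X →ₗ[B] Y) (g : Y →ₗ[B] Z) (h : Function.Exact f g) :
    ShortComplex (ModuleCat.{0} B) :=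
  ShortComplex.mk (ModuleCat.ofHom f) (ModuleCat.ofHom g) (by
    ext x; exact (h (f x)).2 ⟨x, rfl⟩)

lemma sc_exact (f : X →ₗ[B] Y) (g : Y →ₗ[B] Z) (h : Function.Exact f g)
    (hf : Function.Injective f) (hg : Function.Surjective g) : (sc f g h).ShortExact :=
  ModuleCat.shortComplex_shortExact _ h hf hg

lemma EV_proj [Module.Projective B X] (i : ℕ) (hi : 1 ≤ i) : EV B X Y i := by
  obtain ⟨j, rfl⟩ : ∃ j, i = j + 1 := ⟨i - 1, by omega⟩
  have : CategoryTheory.Projective (ModuleCat.of B X) :=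
    (IsProjective.iff_projective X).1 inferInstance
  exact Ext.subsingleton_of_projective _ _ _

lemma EV_inj [Module.Injective B Y] (i : ℕ) (hi : 1 ≤ i) : EV B X Y i := by
  obtain ⟨j, rfl⟩ : ∃ j, i = j + 1 := ⟨i - 1, by omega⟩
  have : CategoryTheory.Injective (ModuleCat.of B Y) :=
    (Module.injective_iff_injective_object B Y).1 inferInstance
  exact Ext.subsingleton_of_injective _ _ _

section
variable {f : X →ₗ[B] Y} {g : Y →ₗ[B] Z} (h : Function.Exact f g)
    (hf : Function.Injective f) (hg : Function.Surjective g)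
include h hf hg

lemma EV_extend (hE : EV B Z W 1) (φ : X →ₗ[B] W) : ∃ ψ : Y →ₗ[B] W, ψ ∘ₗ f = φ := by
  have hS := sc_exact f g h hf hg
  unfold EV at hE
  obtain ⟨x, hx⟩ := Ext.contravariant_sequence_exact₁ hS (ModuleCat.of B W)
    (Ext.mk₀ (ModuleCat.ofHom φ)) (n₁ := 1) rfl
    (@Subsingleton.elim _ hE _ _)
  obtain ⟨y, rfl⟩ := (Ext.mk₀_bijective _ _).2 x
  rw [Ext.mk₀_comp_mk₀] at hx
  have := (Ext.mk₀_bijective _ _).1 hx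
  refine ⟨y.hom, ?_⟩
  exact congrArg ModuleCat.Hom.hom this

lemma EV_lift (hE : EV B W X 1) (φ : W →ₗ[B] Z) : ∃ ψ : W →ₗ[B] Y, g ∘ₗ ψ = φ := by
  have hS := sc_exact f g h hf hg
  unfold EV at hE
  obtain ⟨x, hx⟩ := Ext.covariant_sequence_exact₃ (ModuleCat.of B W) hS
    (Ext.mk₀ (ModuleCat.ofHom φ)) (n₁ := 1) rfl
    (@Subsingleton.elim _ hE _ _)
  obtain ⟨y, rfl⟩ := (Ext.mk₀_bijective _ _).2 x
  rw [Ext.mk₀_comp_mk₀] at hx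
  have := (Ext.mk₀_bijective _ _).1 hx
  refine ⟨y.hom, ?_⟩
  exact congrArg ModuleCat.Hom.hom this

lemma EV_one_of_extend (hY : EV B Y W 1)
    (H : ∀ φ : X →ₗ[B] W, ∃ ψ : Y →ₗ[B] W, ψ ∘ₗ f = φ) : EV B Z W 1 := by
  have hS := sc_exact f g h hf hg
  refine subsingleton_of_forall_eq 0 fun e => ?_
  obtain ⟨x, rfl⟩ := Ext.contravariant_sequence_exact₃ hS (ModuleCat.of B W) e
    (@Subsingleton.elim _ hY _ _) (n₀ := 0) rfl
  obtain ⟨y, rfl⟩ := (Ext.mk₀_bijective _ _).2 x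
  obtain ⟨ψ, hψ⟩ := H y.hom
  have : y = (sc f g h).f ≫ ModuleCat.ofHom ψ := by
    ext x
    exact (LinearMap.congr_fun hψ x).symm
  rw [this, ← Ext.mk₀_comp_mk₀]
  exact hS.extClass_comp_assoc _

lemma EV_third_contra (i : ℕ) (hX : EV B X W i) (hY : EV B Y W (i+1)) : EV B Z W (i+1) := by
  have hS := sc_exact f g h hf hg
  refine subsingleton_of_forall_eq 0 fun e => ?_
  obtain ⟨x, rfl⟩ := Ext.contravariant_sequence_exact₃ hS (ModuleCat.of B W) e
    (@Subsingleton.elim _ hY _ _) (n₀ := i) (by omega)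
  rw [@Subsingleton.elim _ hX x 0]
  simp

lemma EV_first_contra (i : ℕ) (hY : EV B Y W i) (hZ : EV B Z W (i+1)) : EV B X W i := by
  have hS := sc_exact f g h hf hg
  refine subsingleton_of_forall_eq 0 fun e => ?_
  obtain ⟨x, rfl⟩ := Ext.contravariant_sequence_exact₁ hS (ModuleCat.of B W) e
    (n₁ := i + 1) (by omega) (@Subsingleton.elim _ hZ _ _)
  rw [@Subsingleton.elim _ hY x 0]
  simp

lemma EV_third_co (i : ℕ) (hY : EV B W Y i) (hX : EV B W X (i+1)) : EV B W Z i := by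
  have hS := sc_exact f g h hf hg
  refine subsingleton_of_forall_eq 0 fun e => ?_
  obtain ⟨x, rfl⟩ := Ext.covariant_sequence_exact₃ (ModuleCat.of B W) hS e
    (n₁ := i + 1) (by omega) (@Subsingleton.elim _ hX _ _)
  rw [@Subsingleton.elim _ hY x 0]
  simp

lemma EV_first_co (i : ℕ) (hY : EV B W Y (i+1)) (hZ : EV B W Z i) : EV B W X (i+1) := by
  have hS := sc_exact f g h hf hg
  refine subsingleton_of_forall_eq 0 fun e => ?_
  obtain ⟨x, rfl⟩ := Ext.covariant_sequence_exact₁ (ModuleCat.of B W) hS e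
    (@Subsingleton.elim _ hY _ _) (n₀ := i) (by omega)
  rw [@Subsingleton.elim _ hZ x 0]
  simp

end

lemma EV_add {Q : ModuleCat.{0} B} {M : ModuleCat.{0} B} (h : InAdd B Q M) (i : ℕ)
    (hQ : EV B W Q i) : EV B W M i := by
  obtain ⟨n, s, r, hrs⟩ := h
  refine subsingleton_of_forall_eq 0 fun e => ?_
  let s' : Fin n → (ModuleCat.of B M ⟶ ModuleCat.of B Q) := fun j =>
    ModuleCat.ofHom (LinearMap.proj j ∘ₗ s)
  let r' : Fin n → (ModuleCat.of B Q ⟶ ModuleCat.of B M) := fun j =>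
    ModuleCat.ofHom (r ∘ₗ LinearMap.single B (fun _ : Fin n => (Q : Type)) j)
  have hid : 𝟙 (ModuleCat.of B M) = ∑ j, s' j ≫ r' j := by
    ext x
    have h1 : r (s x) = x := LinearMap.congr_fun hrs x
    have h2 : s x = ∑ j, Pi.single j (s x j) := (Finset.univ_sum_single (s x)).symm
    simp only [ModuleCat.hom_sum, LinearMap.sum_apply]
    change x = ∑ j, r (Pi.single j (s x j))
    rw [← map_sum, ← h2, h1]
  rw [← Ext.comp_mk₀_id e, hid, Ext.mk₀_sum, Ext.comp_sum]
  refine Finset.sum_eq_zero fun j _ => ?_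
  rw [← Ext.mk₀_comp_mk₀, ← Ext.comp_assoc_of_second_deg_zero,
    @Subsingleton.elim _ hQ (e.comp _ _) 0]
  simp

lemma EV_iso_right (e : X ≃ₗ[B] Y) (i : ℕ) (hX : EV B W X i) : EV B W Y i := by
  refine subsingleton_of_forall_eq 0 fun x => ?_
  have hid : 𝟙 (ModuleCat.of B Y) = ModuleCat.ofHom e.symm.toLinearMap ≫ ModuleCat.ofHom e.toLinearMap := by
    ext x; simp
  rw [← Ext.comp_mk₀_id x, hid, ← Ext.mk₀_comp_mk₀, ← Ext.comp_assoc_of_second_deg_zero,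
    @Subsingleton.elim _ hX (x.comp _ _) 0]
  simp

lemma EV_iso_left (e : X ≃ₗ[B] Y) (i : ℕ) (hX : EV B X W i) : EV B Y W i := by
  refine subsingleton_of_forall_eq 0 fun x => ?_
  have hid : 𝟙 (ModuleCat.of B Y) = ModuleCat.ofHom e.symm.toLinearMap ≫ ModuleCat.ofHom e.toLinearMap := by
    ext x; simp
  rw [← Ext.mk₀_id_comp x, hid, ← Ext.mk₀_comp_mk₀_assoc,
    @Subsingleton.elim _ hX ((Ext.mk₀ (ModuleCat.ofHom e.toLinearMap)).comp x _) 0]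
  simp

end ExtTools
end P10

namespace P10
open Paper CategoryTheory CategoryTheory.Abelian

section Res
variable {B : Type} [Ring B]

lemma exact_ker_subtype {X Y : Type} [AddCommGroup X] [Module B X] [AddCommGroup Y] [Module B Y]
    (g : X →ₗ[B] Y) : Function.Exact (LinearMap.ker g).subtype g := by
  intro x
  constructor
  · intro h; exact ⟨⟨x, h⟩, rfl⟩
  · rintro ⟨y, rfl⟩; exact y.2

lemma EV_of_res {W : Type} [AddCommGroup W] [Module B W] (s : ℕ) :
    ∀ (X : Type) [AddCommGroup X] [Module B X] (F : ℕ → ModuleCat.{0} B)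
      (d : ∀ j, F (j+1) →ₗ[B] F j) (aug : F 0 →ₗ[B] X),
      (∀ j, j < s → Module.Projective B (F j)) → Function.Surjective aug →
      (1 ≤ s → Function.Exact (d 0) aug) →
      (∀ j, j + 2 ≤ s → Function.Exact (d (j+1)) (d j)) →
      (∀ j, j < s → ∀ φ : F (j+1) →ₗ[B] W, φ ∘ₗ d (j+1) = 0 →
        ∃ ψ : F j →ₗ[B] W, φ = ψ ∘ₗ d j) →
      (∀ j, j + 2 ≤ s + 1 → ∀ x, d j (d (j+1) x) = 0) →
      ∀ i, 1 ≤ i → i ≤ s → EV B X W i := by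
  induction s with
  | zero => intros; omega
  | succ s ih =>
    intro X _ _ F d aug hproj hsurj hex0 hex hco hzero i hi his
    have : Module.Projective B (F 0) := hproj 0 (by omega)
    have hk := exact_ker_subtype aug
    have hki : Function.Injective (LinearMap.ker aug).subtype := Subtype.val_injective
    have hmem : ∀ x, d 0 x ∈ LinearMap.ker aug := fun x => (hex0 (by omega) _).2 ⟨x, rfl⟩
    let aug' : F 1 →ₗ[B] LinearMap.ker aug := (d 0).codRestrict _ hmem
    have hsurj' : Function.Surjective aug' := by
      rintro ⟨y, hy⟩
      obtain ⟨x, hx⟩ := (hex0 (by omega) y).1 hy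
      exact ⟨x, Subtype.ext hx⟩
    rcases Nat.eq_or_lt_of_le hi with rfl | hi2
    · refine EV_one_of_extend hk hki hsurj (EV_proj 1 le_rfl) fun φ => ?_
      obtain ⟨ψ, hψ⟩ := hco 0 (by omega) (φ ∘ₗ aug') (by
        ext x
        have : aug' (d 1 x) = 0 := Subtype.ext (hzero 0 (by omega) x)
        simp [this])
      refine ⟨ψ, ?_⟩
      ext y
      obtain ⟨x, rfl⟩ := hsurj' y
      exact (LinearMap.congr_fun hψ x).symm
    · obtain ⟨j, rfl⟩ : ∃ j, i = j + 1 := ⟨i - 1, by omega⟩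
      refine EV_third_contra hk hki hsurj j ?_ (EV_proj _ (by omega))
      refine ih (LinearMap.ker aug) (fun j => F (j+1)) (fun j => d (j+1)) aug'
        (fun j hj => hproj _ (by omega)) hsurj' ?_ (fun j hj => hex _ (by omega))
        (fun j hj => hco _ (by omega)) (fun j hj => hzero _ (by omega)) j (by omega) (by omega)
      intro hs x
      rw [← hex 0 (by omega) x]
      exact Subtype.ext_iff

section exists_res
variable (X : ModuleCat.{0} B)

/-- iterated syzygies along free covers -/
noncomputable def freeK : ℕ → ModuleCat.{0} B
  | 0 => X
  | (n+1) => ModuleCat.of B (LinearMap.ker (Finsupp.linearCombination B (id : freeK n → freeK n)))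

/-- the free covers -/
noncomputable def freeP (n : ℕ) : ModuleCat.{0} B := ModuleCat.of B (freeK X n →₀ B)

/-- the covering maps -/
noncomputable def freep (n : ℕ) : freeP X n →ₗ[B] freeK X n :=
  Finsupp.linearCombination B (id : freeK X n → freeK X n)

/-- the inclusions -/
noncomputable def freei (n : ℕ) : freeK X (n+1) →ₗ[B] freeP X n :=
  (LinearMap.ker (Finsupp.linearCombination B (id : freeK X n → freeK X n))).subtype

lemma freep_surj (n : ℕ) : Function.Surjective (freep X n) := fun x =>
  ⟨Finsupp.single x 1, (Finsupp.linearCombination_single B 1 x).trans (one_smul B _)⟩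

lemma freei_inj (n : ℕ) : Function.Injective (freei X n) := Subtype.val_injective

lemma free_exact (n : ℕ) : Function.Exact (freei X n) (freep X n) := exact_ker_subtype _

/-- a projective resolution -/
noncomputable def freeRes : ProjRes B X where
  P := freeP X
  d j := freei X j ∘ₗ freep X (j+1)
  aug := freep X 0
  proj j := by unfold freeP; infer_instance
  augSurj := freep_surj X 0
  exact0 := by
    intro x
    refine (free_exact X 0 x).trans ?_
    constructor
    · rintro ⟨y, rfl⟩
      obtain ⟨z, rfl⟩ := freep_surj X 1 y
      exact ⟨z, rfl⟩
    · rintro ⟨y, rfl⟩; exact ⟨_, rfl⟩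
  exact j := by
    intro x
    have h0 : (freei X j ∘ₗ freep X (j+1)) x = 0 ↔ freep X (j+1) x = 0 :=
      map_eq_zero_iff _ (freei_inj X j)
    rw [h0, free_exact X (j+1) x]
    constructor
    · rintro ⟨y, rfl⟩
      obtain ⟨z, rfl⟩ := freep_surj X _ y
      exact ⟨z, rfl⟩
    · rintro ⟨y, rfl⟩; exact ⟨_, rfl⟩

end exists_res

lemma EV_of_selfOrth (Q : ModuleCat.{0} B) (h : SelfOrth B Q) (i : ℕ) (hi : 1 ≤ i) :
    EV B Q Q i := by
  let R := freeRes Q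
  refine EV_of_res i Q R.P R.d R.aug (fun j _ => R.proj j) R.augSurj (fun _ => R.exact0)
    (fun j _ => R.exact j) (fun j _ φ hφ => h (j+1) (by omega) R φ hφ)
    (fun j _ x => (R.exact j _).2 ⟨x, rfl⟩) i hi le_rfl

lemma zeroMod_hom {W : Type} [AddCommGroup W] [Module B W] (f : zeroMod B →ₗ[B] W) : f = 0 := by
  refine LinearMap.ext fun x => ?_
  have hx : x = 0 := @Subsingleton.elim PUnit _ _ _
  rw [hx, map_zero, map_zero]

lemma EV_of_pdLE {W : Type} [AddCommGroup W] [Module B W] (m : ℕ) :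
    ∀ X : ModuleCat.{0} B, pdLE B X m → ∀ i, m < i → EV B X W i := by
  induction m with
  | zero =>
    rintro X ⟨P, d, aug, hT, hS, hsurj, hex0, hex, -⟩ i hi
    have := hT 0 le_rfl
    have := hS 1 (by omega)
    have hinj : Function.Injective aug := by
      rw [injective_iff_map_eq_zero]
      intro x hx
      obtain ⟨y, rfl⟩ := (hex0 x).1 hx
      rw [Subsingleton.elim y 0, map_zero]
    exact EV_iso_left (LinearEquiv.ofBijective aug ⟨hinj, hsurj⟩) i (EV_proj i hi)
  | succ m ih =>
    rintro X ⟨P, d, aug, hT, hS, hsurj, hex0, hex, -⟩ i hi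
    have := hT 0 (by omega)
    obtain ⟨j, rfl⟩ : ∃ j, i = j + 1 := ⟨i - 1, by omega⟩
    refine EV_third_contra (exact_ker_subtype aug) Subtype.val_injective hsurj j ?_
      (EV_proj _ (by omega))
    have hmem : ∀ x, d 0 x ∈ LinearMap.ker aug := fun x => (hex0 _).2 ⟨x, rfl⟩
    refine ih (ModuleCat.of B (LinearMap.ker aug))
      ⟨fun j => P (j+1), fun j => d (j+1), (d 0).codRestrict _ hmem,
      fun j hj => hT _ (by omega), fun j hj => hS _ (by omega), ?_, ?_, fun j => hex _, ?_, ?_, ?_⟩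
      j (by omega)
    · rintro ⟨y, hy⟩
      obtain ⟨x, hx⟩ := (hex0 y).1 hy
      exact ⟨x, Subtype.ext hx⟩
    · intro x
      rw [← hex 0 x]
      exact Subtype.ext_iff
    · intro f
      have hf : f = 0 := zeroMod_hom f
      exact ⟨0, by rw [hf, LinearMap.comp_zero]⟩
    · intro f _
      have hf : f = 0 := zeroMod_hom f
      exact ⟨0, by rw [hf, LinearMap.comp_zero]⟩
    · intro j f _
      have hf : f = 0 := zeroMod_hom f
      exact ⟨0, by rw [hf, LinearMap.comp_zero]⟩

lemma EV_of_idLE {W : Type} [AddCommGroup W] [Module B W] (m : ℕ) :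
    ∀ X : ModuleCat.{0} B, idLE B X m → ∀ i, m < i → EV B W X i := by
  induction m with
  | zero =>
    rintro X ⟨M, ι, d, hT, hS, hinj, hex0, hex, -⟩ i hi
    have := hT 0 le_rfl
    have := hS 1 (by omega)
    have hsurj : Function.Surjective ι := fun x => (hex0 x).1 (Subsingleton.elim _ _)
    exact EV_iso_right (LinearEquiv.ofBijective ι ⟨hinj, hsurj⟩).symm i (EV_inj i hi)
  | succ m ih =>
    rintro X ⟨M, ι, d, hT, hS, hinj, hex0, hex, -⟩ i hi
    have := hT 0 (by omega)
    obtain ⟨j, rfl⟩ : ∃ j, i = j + 1 := ⟨i - 1, by omega⟩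
    have hex' : Function.Exact ι (d 0).rangeRestrict := by
      intro x
      rw [← hex0 x]
      exact Subtype.ext_iff
    refine EV_first_co hex' hinj (LinearMap.surjective_rangeRestrict _) j (EV_inj _ (by omega)) ?_
    refine ih (ModuleCat.of B (LinearMap.range (d 0)))
      ⟨fun j => M (j+1), (LinearMap.range (d 0)).subtype, fun j => d (j+1),
      fun j hj => hT _ (by omega), fun j hj => hS _ (by omega), Subtype.val_injective, ?_,
      fun j => hex _, ?_, ?_, ?_⟩
      j (by omega)
    · intro x
      rw [hex 0 x]
      constructor
      · intro h; exact ⟨⟨x, h⟩, rfl⟩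
      · rintro ⟨y, rfl⟩; exact y.2
    · intro f
      exact ⟨0, LinearMap.ext fun x => @Subsingleton.elim PUnit _ _ _⟩
    · intro f _
      exact ⟨0, LinearMap.ext fun x => @Subsingleton.elim PUnit _ _ _⟩
    · intro j f _
      exact ⟨0, LinearMap.ext fun x => @Subsingleton.elim PUnit _ _ _⟩

end Res
end P10

namespace P10
open Paper CategoryTheory CategoryTheory.Abelian

section Dom
variable {A : Type} [Ring A] (Q : ModuleCat.{0} A)

lemma ev_surj {M : ModuleCat.{0} A} (hM : InAdd A Q M)
    (φ : (M →ₗ[A] Q) →ₗ[Module.End A Q] Q) : ∃ m : M, ∀ f : M →ₗ[A] Q, φ f = f m := by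
  obtain ⟨n, s, r, hrs⟩ := hM
  refine ⟨r (fun j => φ (LinearMap.proj j ∘ₗ s)), fun f => ?_⟩
  let e : Fin n → Module.End A Q := fun j =>
    f ∘ₗ r ∘ₗ LinearMap.single A (fun _ : Fin n => (Q : Type)) j
  have hf : f = ∑ j, e j • (LinearMap.proj j ∘ₗ s : M →ₗ[A] Q) := by
    ext x
    have h1 : r (s x) = x := LinearMap.congr_fun hrs x
    have h2 : s x = ∑ j, Pi.single j (s x j) := (Finset.univ_sum_single (s x)).symm
    simp only [LinearMap.sum_apply]
    change f x = ∑ j, f (r (Pi.single j (s x j)))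
    rw [← map_sum, ← map_sum, ← h2, h1]
  conv_lhs => rw [hf]
  rw [map_sum]
  simp only [map_smul]
  change ∑ j, f (r (Pi.single j (φ (LinearMap.proj j ∘ₗ s)))) = _
  rw [← map_sum, ← map_sum, Finset.univ_sum_single (fun j => φ (LinearMap.proj j ∘ₗ s))]

lemma ev_inj {M : ModuleCat.{0} A} (hM : InAdd A Q M) (m : M)
    (h : ∀ f : M →ₗ[A] Q, f m = 0) : m = 0 := by
  obtain ⟨n, s, r, hrs⟩ := hM
  have h1 : r (s m) = m := LinearMap.congr_fun hrs m
  have h2 : s m = 0 := by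
    ext j
    exact h (LinearMap.proj j ∘ₗ s)
  rw [← h1, h2, map_zero]

lemma hom_proj {M : ModuleCat.{0} A} (hM : InAdd A Q M) :
    Module.Projective (Module.End A Q) (M →ₗ[A] Q) := by
  obtain ⟨n, s, r, hrs⟩ := hM
  let i : (M →ₗ[A] Q) →ₗ[Module.End A Q] (Fin n → Module.End A Q) :=
    { toFun := fun f j => f ∘ₗ r ∘ₗ LinearMap.single A (fun _ : Fin n => (Q : Type)) j
      map_add' := fun f g => rfl
      map_smul' := fun e f => rfl }
  let p : (Fin n → Module.End A Q) →ₗ[Module.End A Q] (M →ₗ[A] Q) :=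
    { toFun := fun e => ∑ j, e j • (LinearMap.proj j ∘ₗ s : M →ₗ[A] Q)
      map_add' := fun f g => by simp [add_smul, Finset.sum_add_distrib]
      map_smul' := fun e f => by simp [Finset.smul_sum, mul_smul] }
  refine Module.Projective.of_split i p ?_
  ext f x
  have h1 : r (s x) = x := LinearMap.congr_fun hrs x
  have h2 : s x = ∑ j, Pi.single j (s x j) := (Finset.univ_sum_single (s x)).symm
  change (∑ j, (f ∘ₗ r ∘ₗ LinearMap.single A (fun _ : Fin n => (Q : Type)) j : Module.End A Q) •
    (LinearMap.proj j ∘ₗ s : M →ₗ[A] Q)) x = f x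
  simp only [LinearMap.sum_apply]
  change ∑ j, f (r (Pi.single j (s x j))) = f x
  rw [← map_sum, ← map_sum, ← h2, h1]

/-- precomposition as a map of left modules over the endomorphism ring -/
def pre {M N : ModuleCat.{0} A} (g : M →ₗ[A] N) :
    (N →ₗ[A] Q) →ₗ[Module.End A Q] (M →ₗ[A] Q) where
  toFun h := h ∘ₗ g
  map_add' _ _ := rfl
  map_smul' _ _ := rfl

lemma dom_facts (n : ℕ) (hn : 3 ≤ n) (h : domdimGE A Q (ModuleCat.of A A) n) :
    (∀ i, 1 ≤ i → i ≤ n - 2 → EV (Module.End A Q) Q Q i) ∧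
    Nonempty (A ≃ₗ[A] (Q →ₗ[Module.End A Q] Q)) := by
  rcases h with h | ⟨M, ι, d, hadd, hinj, hex0, hex, hl0, hl1, hl⟩
  · omega
  let aug : (M 0 →ₗ[A] Q) →ₗ[Module.End A Q] Q :=
    { toFun := fun f => f (ι (1 : A))
      map_add' := fun _ _ => rfl
      map_smul' := fun _ _ => rfl }
  have haug : ∀ (f : M 0 →ₗ[A] Q) (a : A), f (ι a) = a • aug f := by
    intro f a
    change f (ι a) = a • f (ι (1 : A))
    rw [← map_smul, ← map_smul]
    congr 2
    exact (mul_one a).symm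
  have haug0 : ∀ f : M 0 →ₗ[A] Q, aug f = 0 ↔ f ∘ₗ ι = 0 := by
    intro f
    constructor
    · intro h
      refine LinearMap.ext fun a => ?_
      have := haug f a
      rw [h, smul_zero] at this
      exact this
    · intro h; exact LinearMap.congr_fun h (1 : A)
  have hsurj : Function.Surjective aug := by
    intro q
    obtain ⟨f, hf⟩ := hl0 (LinearMap.toSpanSingleton A Q q)
    refine ⟨f, ?_⟩
    have := LinearMap.congr_fun hf (1 : A)
    exact this.trans (one_smul A q)
  have hdd : ∀ j, j + 3 ≤ n → d (j+1) ∘ₗ d j = 0 := fun j hj =>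
    LinearMap.ext fun x => (hex j hj _).2 ⟨x, rfl⟩
  have hdι : d 0 ∘ₗ ι = 0 := LinearMap.ext fun x => (hex0 (by omega) _).2 ⟨x, rfl⟩
  have hexa : Function.Exact (pre Q (d 0)) aug := by
    intro f
    rw [haug0 f]
    constructor
    · intro h
      obtain ⟨g, hg⟩ := hl1 (by omega) f h
      exact ⟨g, hg⟩
    · rintro ⟨g, rfl⟩
      change (g ∘ₗ d 0) ∘ₗ ι = 0
      rw [LinearMap.comp_assoc, hdι, LinearMap.comp_zero]
  have hzero : ∀ j, j + 3 ≤ n → ∀ f, pre Q (d j) (pre Q (d (j+1)) f) = 0 := by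
    intro j hj f
    change (f ∘ₗ d (j+1)) ∘ₗ d j = 0
    rw [LinearMap.comp_assoc, hdd j hj, LinearMap.comp_zero]
  constructor
  · refine EV_of_res (n - 2) Q (fun j => ModuleCat.of (Module.End A Q) (M j →ₗ[A] Q))
      (fun j => pre Q (d j)) aug (fun j hj => hom_proj Q (hadd j (by omega))) hsurj
      (fun _ => hexa) ?_ ?_ (fun j hj => hzero j (by omega))
    · intro j hj f
      constructor
      · intro h
        obtain ⟨g, hg⟩ := hl j (by omega) f h
        exact ⟨g, hg⟩
      · rintro ⟨g, rfl⟩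
        exact hzero j (by omega) g
    · intro j hj φ hφ
      obtain ⟨m, hm⟩ := ev_surj Q (hadd (j+1) (by omega)) φ
      have h0 : d (j+1) m = 0 := by
        refine ev_inj Q (hadd (j+2) (by omega)) _ fun f => ?_
        have := LinearMap.congr_fun hφ f
        exact (hm (f ∘ₗ d (j+1))).symm.trans this
      obtain ⟨m', rfl⟩ := (hex j (by omega) m).1 h0
      refine ⟨{ toFun := fun f => f m', map_add' := fun _ _ => rfl, map_smul' := fun _ _ => rfl },
        ?_⟩
      exact LinearMap.ext fun f => hm f
  · let T : A →ₗ[A] (Q →ₗ[Module.End A Q] Q) :=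
      { toFun := fun a => toEndE A Q a
        map_add' := fun a b => map_add _ a b
        map_smul' := fun a b => by
          refine LinearMap.ext fun q => ?_
          exact mul_smul a b q }
    refine ⟨LinearEquiv.ofBijective T ⟨?_, ?_⟩⟩
    · rw [injective_iff_map_eq_zero]
      intro a ha
      have : ι a = 0 := by
        refine ev_inj Q (hadd 0 (by omega)) _ fun f => ?_
        rw [haug f a]
        exact LinearMap.congr_fun ha (aug f)
      exact hinj (this.trans (map_zero ι).symm)
    · intro φ
      obtain ⟨m, hm⟩ := ev_surj Q (hadd 0 (by omega)) (φ ∘ₗ aug)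
      have h0 : d 0 m = 0 := by
        refine ev_inj Q (hadd 1 (by omega)) _ fun f => ?_
        refine (hm (f ∘ₗ d 0)).symm.trans ?_
        have : aug (f ∘ₗ d 0) = 0 := (hexa _).2 ⟨f, rfl⟩
        rw [LinearMap.comp_apply, this, map_zero]
      obtain ⟨a, rfl⟩ := (hex0 (by omega) m).1 h0
      refine ⟨a, LinearMap.ext fun q => ?_⟩
      obtain ⟨f, rfl⟩ := hsurj q
      exact ((hm f).trans (haug f a)).symm

end Dom

section Omega
variable {A : Type} [Ring A] (Q : ModuleCat.{0} A)

lemma hom_inAdd (P : ModuleCat.{0} (Module.End A Q)) [Module.Projective (Module.End A Q) P]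
    [Module.Finite (Module.End A Q) P] :
    InAdd A Q (ModuleCat.of A (P →ₗ[Module.End A Q] Q)) := by
  obtain ⟨n, p, hp⟩ := Module.Finite.exists_fin' (Module.End A Q) P
  obtain ⟨i, hi⟩ := Module.projective_lifting_property p LinearMap.id hp
  refine ⟨n,
    { toFun := fun φ j => φ (p (Pi.single j 1))
      map_add' := fun _ _ => rfl
      map_smul' := fun _ _ => rfl },
    { toFun := fun q =>
        { toFun := fun x => ∑ j, i x j • q j
          map_add' := ?_
          map_smul' := ?_ }
      map_add' := ?_
      map_smul' := ?_ }, ?_⟩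
  · intro x y; simp [add_smul, Finset.sum_add_distrib]
  · intro e x; simp [Finset.smul_sum, mul_smul]
  · intro q q'; ext x; simp [smul_add, Finset.sum_add_distrib]
  · intro a q
    refine LinearMap.ext fun x => ?_
    change ∑ j, i x j • (a • q j) = a • ∑ j, i x j • q j
    rw [Finset.smul_sum]
    exact Finset.sum_congr rfl fun j _ => smul_comm _ _ _
  · refine LinearMap.ext fun φ => LinearMap.ext fun x => ?_
    change ∑ j, i x j • φ (p (Pi.single j 1)) = φ x
    have h1 : p (i x) = x := LinearMap.congr_fun hi x
    conv_rhs => rw [← h1, pi_eq_sum_univ' (i x)]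
    rw [map_sum, map_sum]
    refine Finset.sum_congr rfl fun j _ => ?_
    rw [map_smul, map_smul]

/-- precomposition as a map of `A`-modules -/
def preA {M N : Type} [AddCommGroup M] [Module (Module.End A Q) M] [AddCommGroup N]
    [Module (Module.End A Q) N] (g : M →ₗ[Module.End A Q] N) :
    (N →ₗ[Module.End A Q] Q) →ₗ[A] (M →ₗ[Module.End A Q] Q) where
  toFun h := h ∘ₗ g
  map_add' _ _ := rfl
  map_smul' _ _ := rfl

lemma fin_of_cover {B : Type} [Ring B] {P X : ModuleCat.{0} B} [Module.Finite B X]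
    (p : P →ₗ[B] X) (h : IsProjCover B p) : Module.Finite B P := by
  obtain ⟨-, hs, hk⟩ := h
  obtain ⟨S, hS⟩ := (Module.Finite.fg_top : (⊤ : Submodule B X).FG)
  choose g hg using hs
  classical
  refine ⟨⟨S.image g, hk _ ?_⟩⟩
  rw [eq_top_iff]
  intro x _
  have hx : p x ∈ Submodule.map p (Submodule.span B (S.image g : Set P)) := by
    rw [Submodule.map_span, Finset.coe_image, Set.image_image]
    simp only [hg, Set.image_id', hS]
    trivial
  obtain ⟨y, hy, hyx⟩ := hx
  have : x = y + (x - y) := by abel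
  rw [this]
  refine Submodule.add_mem_sup hy ?_
  rw [LinearMap.mem_ker, map_sub, hyx, sub_self]

lemma omega_facts [IsNoetherianRing (Module.End A Q)] (s : ℕ) :
    ∀ X Z : ModuleCat.{0} (Module.End A Q), Module.Finite (Module.End A Q) X →
      (∀ i, 1 ≤ i → i ≤ s → EV (Module.End A Q) X Q i) →
      IsOmegaOf (Module.End A Q) s X Z →
      Module.Finite (Module.End A Q) Z ∧
      ∀ (W : Type) [AddCommGroup W] [Module A W] (N : ℕ), (∀ i, N ≤ i → EV A W Q i) →
        (∀ i, N + s ≤ i → EV A W (X →ₗ[Module.End A Q] Q) i) →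
        ∀ i, N ≤ i → EV A W (Z →ₗ[Module.End A Q] Q) i := by
  induction s with
  | zero =>
    rintro X Z hX - ⟨e⟩
    refine ⟨Module.Finite.equiv e.symm, fun W _ _ N _ h i hi => ?_⟩
    refine EV_iso_right ?_ i (h i hi)
    exact LinearEquiv.ofLinearMap (preA Q e.toLinearMap) (preA Q e.symm.toLinearMap)
      (LinearMap.ext fun f => LinearMap.ext fun x => congrArg f (e.symm_apply_apply x))
      (LinearMap.ext fun f => LinearMap.ext fun x => congrArg f (e.apply_symm_apply x))
  | succ s ih =>
    rintro X Z hX hE ⟨Y, ⟨P, p, hp, ⟨e⟩⟩, hZ⟩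
    have hPf := fin_of_cover p hp
    have hPp := hp.1
    let j : Y →ₗ[Module.End A Q] P := (LinearMap.ker p).subtype ∘ₗ e.toLinearMap
    have hj : Function.Injective j := Subtype.val_injective.comp e.injective
    have hex : Function.Exact j p := by
      intro x
      rw [exact_ker_subtype p x]
      constructor
      · rintro ⟨y, rfl⟩
        exact ⟨e.symm y, by simp [j]⟩
      · rintro ⟨y, rfl⟩
        exact ⟨e y, rfl⟩
    have hYf : Module.Finite (Module.End A Q) Y := Module.Finite.equiv e.symm
    obtain ⟨h1, h2⟩ := ih Y Z hYf (fun i hi hs =>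
      EV_first_contra hex hj hp.2.1 i (EV_proj i hi) (hE (i+1) (by omega) (by omega))) hZ
    refine ⟨h1, fun W _ _ N hQ hXi => h2 W N hQ fun i hi => ?_⟩
    refine EV_third_co (f := preA Q p) (g := preA Q j) ?_ ?_ ?_ i
      (EV_add (hom_inAdd Q P) i (hQ i (by omega))) (hXi (i+1) (by omega))
    · intro f
      constructor
      · intro h
        have hk : LinearMap.ker p ≤ LinearMap.ker f := by
          intro x hx
          obtain ⟨y, rfl⟩ := (hex x).1 hx
          exact LinearMap.congr_fun h y
        refine ⟨(LinearMap.ker p).liftQ f hk ∘ₗ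
          (p.quotKerEquivOfSurjective hp.2.1).symm.toLinearMap, LinearMap.ext fun x => ?_⟩
        change (LinearMap.ker p).liftQ f hk ((p.quotKerEquivOfSurjective hp.2.1).symm (p x)) = f x
        have : (p.quotKerEquivOfSurjective hp.2.1).symm (p x) = Submodule.Quotient.mk x := by
          rw [LinearEquiv.symm_apply_eq]; rfl
        rw [this]
        exact Submodule.liftQ_apply _ _ _
      · rintro ⟨g, rfl⟩
        refine LinearMap.ext fun y => ?_
        change g (p (j y)) = 0
        rw [(hex (j y)).2 ⟨y, rfl⟩, map_zero]
    · intro f g h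
      refine LinearMap.ext fun x => ?_
      obtain ⟨y, rfl⟩ := hp.2.1 x
      exact LinearMap.congr_fun h y
    · intro f
      exact EV_extend hex hj hp.2.1 (hE 1 le_rfl (by omega)) f

end Omega
end P10

namespace P10
open Paper CategoryTheory CategoryTheory.Abelian

section Splice
variable {B : Type} [Ring B] {Q : ModuleCat.{0} B} {T : ModuleCat.{0} B → Prop}

lemma ResLE_zero {X : ModuleCat.{0} B} (hX : T X) : ResLE B Q T X 0 := by
  refine ⟨fun j => Nat.casesOn j X (fun _ => zeroMod B), fun j => 0, LinearMap.id, ?_, ?_,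
    Function.surjective_id, ?_, ?_, fun f => ⟨f, rfl⟩, ?_, ?_⟩
  · intro j hj
    obtain rfl : j = 0 := by omega
    exact hX
  · intro j hj
    obtain ⟨i, rfl⟩ : ∃ i, j = i + 1 := ⟨j - 1, by omega⟩
    exact (inferInstance : Subsingleton PUnit)
  · intro x
    constructor
    · rintro rfl; exact ⟨0, rfl⟩
    · rintro ⟨y, rfl⟩; rfl
  · intro j x
    constructor
    · intro _; exact ⟨0, @Subsingleton.elim PUnit _ _ _⟩
    · intro _; rfl
  · intro f hf
    exact ⟨0, by rw [LinearMap.comp_zero]; exact hf.symm⟩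
  · intro j f hf
    exact ⟨0, LinearMap.ext fun x => @Subsingleton.elim PUnit _ _ _⟩

lemma ResLE_iso {X X' : ModuleCat.{0} B} (e : X ≃ₗ[B] X') {m : ℕ} (h : ResLE B Q T X m) :
    ResLE B Q T X' m := by
  obtain ⟨P, d, aug, h1, h2, h3, h4, h5, h6, h7, h8⟩ := h
  have he : ∀ f : Q →ₗ[B] P 0, (e.toLinearMap ∘ₗ aug) ∘ₗ f = 0 → aug ∘ₗ f = 0 := by
    intro f hf
    refine LinearMap.ext fun x => e.injective ?_
    exact (LinearMap.congr_fun hf x).trans (map_zero e).symm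
  refine ⟨P, d, e.toLinearMap ∘ₗ aug, h1, h2, e.surjective.comp h3, ?_, h5, ?_,
    fun f hf => h7 f (he f hf), h8⟩
  · intro x
    rw [← h4 x]
    exact map_eq_zero_iff e e.injective
  · intro f
    obtain ⟨g, hg⟩ := h6 (e.symm.toLinearMap ∘ₗ f)
    refine ⟨g, ?_⟩
    rw [LinearMap.comp_assoc, hg]
    ext x; simp

/-- terms of the spliced sequence -/
def spliceP (P : ModuleCat.{0} B) (tail : ℕ → ModuleCat.{0} B) : ℕ → ModuleCat.{0} B
  | 0 => P
  | (j+1) => tail j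

/-- maps of the spliced sequence -/
def spliced (P : ModuleCat.{0} B) (P' : ℕ → ModuleCat.{0} B)
    (d : ∀ j, (P' (j+1) : Type) →ₗ[B] (P' j : Type)) (a : (P' 0 : Type) →ₗ[B] (P : Type)) :
    ∀ j, (spliceP P P' (j+1) : Type) →ₗ[B] (spliceP P P' j : Type)
  | 0 => a
  | (j+1) => d j

lemma ResLE_splice {X X' P : ModuleCat.{0} B} {f : X' →ₗ[B] P} {g : P →ₗ[B] X} (hP : T P)
    (hf : Function.Injective f) (hg : Function.Surjective g) (hfg : Function.Exact f g)
    (hl : ∀ φ : Q →ₗ[B] X, ∃ ψ : Q →ₗ[B] P, g ∘ₗ ψ = φ) {m : ℕ} (h : ResLE B Q T X' m) :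
    ResLE B Q T X (m+1) := by
  obtain ⟨P', d, aug, h1, h2, h3, h4, h5, h6, h7, h8⟩ := h
  let P2 : ℕ → ModuleCat.{0} B := spliceP P P'
  let d2 : ∀ j, (P2 (j+1) : Type) →ₗ[B] (P2 j : Type) := spliced P P' d (f ∘ₗ aug)
  refine ⟨P2, d2, g, ?_, ?_, hg, ?_, ?_, hl, ?_, ?_⟩
  · rintro (_ | j) hj
    · exact hP
    · exact h1 j (by omega)
  · rintro (_ | j) hj
    · omega
    · exact h2 j (by omega)
  · intro x
    refine (hfg x).trans ?_
    constructor
    · rintro ⟨y, rfl⟩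
      obtain ⟨z, rfl⟩ := h3 y
      exact ⟨z, rfl⟩
    · rintro ⟨y, rfl⟩
      exact ⟨aug y, rfl⟩
  · rintro (_ | j)
    · intro x
      exact (map_eq_zero_iff f hf).trans (h4 x)
    · exact h5 j
  · intro φ hφ
    have hmem : ∀ x, φ x ∈ LinearMap.range f := fun x => (hfg _).1 (LinearMap.congr_fun hφ x)
    let e := LinearEquiv.ofInjective f hf
    obtain ⟨ψ, hψ⟩ := h6 (e.symm.toLinearMap ∘ₗ φ.codRestrict _ hmem)
    refine ⟨ψ, LinearMap.ext fun x => ?_⟩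
    change f (aug (ψ x)) = φ x
    have h := LinearMap.congr_fun hψ x
    change aug (ψ x) = e.symm ⟨φ x, hmem x⟩ at h
    rw [h]
    exact congrArg Subtype.val (e.apply_symm_apply ⟨φ x, hmem x⟩)
  · rintro (_ | j) φ hφ
    · refine h7 φ (LinearMap.ext fun x => hf ?_)
      exact (LinearMap.congr_fun hφ x).trans (map_zero f).symm
    · exact h8 j φ hφ

end Splice

noncomputable section Dual
variable (k : Type) [Field k] {B : Type} [Ring B] [Algebra k B]

/-- an element of the dual module as a functional -/
def toD {Y : ModuleCat.{0} Bᵐᵒᵖ} (φ : Dunop k B Y) : Y →ₗ[k] k := φ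

/-- a functional as an element of the dual module -/
def ofD {Y : ModuleCat.{0} Bᵐᵒᵖ} (φ : Y →ₗ[k] k) : Dunop k B Y := φ

lemma toD_ofD {Y : ModuleCat.{0} Bᵐᵒᵖ} (φ : Y →ₗ[k] k) : toD k (ofD k φ) = φ := rfl

lemma D_ext {Y : ModuleCat.{0} Bᵐᵒᵖ} {φ ψ : Dunop k B Y} (h : ∀ y, toD k φ y = toD k ψ y) :
    φ = ψ := LinearMap.ext h

lemma toD_add {Y : ModuleCat.{0} Bᵐᵒᵖ} (φ ψ : Dunop k B Y) (y : Y) :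
    toD k (φ + ψ) y = toD k φ y + toD k ψ y := rfl

lemma toD_zero {Y : ModuleCat.{0} Bᵐᵒᵖ} (y : Y) :
    toD k (0 : Dunop k B Y) y = 0 := rfl

lemma toD_sum {Y : ModuleCat.{0} Bᵐᵒᵖ} {ι : Type} (s : Finset ι) (φ : ι → Dunop k B Y) (y : Y) :
    toD k (∑ i ∈ s, φ i) y = ∑ i ∈ s, toD k (φ i) y := by
  classical
  induction s using Finset.induction_on with
  | empty => simp [toD_zero]
  | insert a s ha ih => rw [Finset.sum_insert ha, Finset.sum_insert ha, toD_add, ih]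

lemma toD_smul {Y : ModuleCat.{0} Bᵐᵒᵖ} (b : B) (φ : Dunop k B Y) (y : Y) :
    toD k (b • φ) y = toD k φ (op b • y) := rfl

lemma toD_scal {Y : ModuleCat.{0} Bᵐᵒᵖ} (c : k) (φ : Dunop k B Y) (y : Y) :
    toD k φ (op (algebraMap k B c) • y) = c * toD k φ y := (toD k φ).map_smul c y

lemma toD_add_right {Y : ModuleCat.{0} Bᵐᵒᵖ} (φ : Dunop k B Y) (x y : Y) :
    toD k φ (x + y) = toD k φ x + toD k φ y := (toD k φ).map_add x y

/-- build an element of the dual module -/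
def mkD {Y : ModuleCat.{0} Bᵐᵒᵖ} (F : Y → k) (h1 : ∀ x y, F (x + y) = F x + F y)
    (h2 : ∀ (c : k) y, F (op (algebraMap k B c) • y) = c * F y) : Dunop k B Y :=
  ofD k { toFun := F, map_add' := h1, map_smul' := h2 }

lemma toD_mkD {Y : ModuleCat.{0} Bᵐᵒᵖ} (F : Y → k) (h1) (h2) (y : Y) :
    toD k (mkD (B := B) k F h1 h2) y = F y := rfl

/-- the dual of a map of right modules -/
def Dmap {Y Y' : ModuleCat.{0} Bᵐᵒᵖ} (f : Y →ₗ[Bᵐᵒᵖ] Y') :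
    Dunop k B Y' →ₗ[B] Dunop k B Y where
  toFun φ := ofD k ((toD k φ) ∘ₗ (f.restrictScalars k))
  map_add' _ _ := rfl
  map_smul' b φ := D_ext k fun y => congrArg (toD k φ) (f.map_smul (op b) y).symm

lemma toD_Dmap {Y Y' : ModuleCat.{0} Bᵐᵒᵖ} (f : Y →ₗ[Bᵐᵒᵖ] Y') (φ : Dunop k B Y') (y : Y) :
    toD k (Dmap k f φ) y = toD k φ (f y) := rfl

variable {Y Y' Y'' : ModuleCat.{0} Bᵐᵒᵖ} {f : Y →ₗ[Bᵐᵒᵖ] Y'} {g : Y' →ₗ[Bᵐᵒᵖ] Y''}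

lemma Dmap_factor (φ : Dunop k B Y') (h : ∀ x, g x = 0 → toD k φ x = 0) :
    ∃ ψ, Dmap k g ψ = φ := by
  have : toD k φ ∈ (LinearMap.ker (g.restrictScalars k)).dualAnnihilator := by
    rw [Submodule.mem_dualAnnihilator]
    exact h
  rw [← LinearMap.range_dualMap_eq_dualAnnihilator_ker] at this
  obtain ⟨ψ, hψ⟩ := this
  exact ⟨ofD k ψ, hψ⟩

lemma Dmap_exact (h : Function.Exact f g) : Function.Exact (Dmap k g) (Dmap k f) := by
  intro φ
  constructor
  · intro hφ
    refine Dmap_factor k φ fun x hx => ?_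
    obtain ⟨y, rfl⟩ := (h x).1 hx
    rw [← toD_Dmap, hφ, toD_zero]
  · rintro ⟨ψ, rfl⟩
    refine D_ext k fun y => ?_
    rw [toD_Dmap, toD_Dmap, (h (f y)).2 ⟨y, rfl⟩, map_zero, toD_zero]

lemma Dmap_surj (h : Function.Injective f) : Function.Surjective (Dmap k f) := by
  intro φ
  refine Dmap_factor k φ fun x hx => ?_
  have : x = 0 := h (hx.trans (map_zero f).symm)
  rw [this, map_zero]

lemma Dmap_inj (h : Function.Surjective f) : Function.Injective (Dmap k f) := by
  intro φ ψ hφ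
  refine D_ext k fun y => ?_
  obtain ⟨x, rfl⟩ := h y
  rw [← toD_Dmap, hφ, toD_Dmap]

/-- duals of isomorphic modules -/
noncomputable def Dequiv (e : Y ≃ₗ[Bᵐᵒᵖ] Y') : Dunop k B Y' ≃ₗ[B] Dunop k B Y :=
  LinearEquiv.ofBijective (Dmap k e.toLinearMap)
    ⟨Dmap_inj k e.surjective, Dmap_surj k e.injective⟩

/-- value of an element of `D(B)` -/
def evD (φ : Dcogen k B) (b : B) : k := toD (Y := ModuleCat.of Bᵐᵒᵖ B) k φ b

lemma evD_ext {φ ψ : Dcogen k B} (h : ∀ b, evD k φ b = evD k ψ b) : φ = ψ :=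
  D_ext (Y := ModuleCat.of Bᵐᵒᵖ B) k h

lemma evD_add (φ ψ : Dcogen k B) (b : B) : evD k (φ + ψ) b = evD k φ b + evD k ψ b := rfl

lemma evD_zero (b : B) : evD k (0 : Dcogen k B) b = 0 := rfl

lemma evD_smul (a : B) (φ : Dcogen k B) (b : B) : evD k (a • φ) b = evD k φ (b * a) := rfl

lemma evD_add_right (φ : Dcogen k B) (b c : B) : evD k φ (b + c) = evD k φ b + evD k φ c :=
  toD_add_right (Y := ModuleCat.of Bᵐᵒᵖ B) k φ b c

lemma evD_scal (φ : Dcogen k B) (c : k) (b : B) :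
    evD k φ (b * algebraMap k B c) = c * evD k φ b :=
  toD_scal (Y := ModuleCat.of Bᵐᵒᵖ B) k c φ b

/-- the map into `D(B)` induced by a functional -/
def coind {X : Type} [AddCommGroup X] [Module B X] (ψ : X → k)
    (h1 : ∀ x y, ψ (x + y) = ψ x + ψ y)
    (h2 : ∀ (c : k) x, ψ (algebraMap k B c • x) = c * ψ x) : X →ₗ[B] Dcogen k B where
  toFun x := mkD (Y := ModuleCat.of Bᵐᵒᵖ B) k (fun (b : B) => ψ (b • x))
    (fun (a b : B) => (congrArg ψ (add_smul a b x)).trans (h1 _ _))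
    (fun c (b : B) => by
      change ψ ((b * algebraMap k B c) • x) = c * ψ (b • x)
      rw [← Algebra.commutes, mul_smul, h2])
  map_add' x y := evD_ext k fun (b : B) => by
    change ψ (b • (x + y)) = ψ (b • x) + ψ (b • y)
    rw [smul_add, h1]
  map_smul' c x := evD_ext k fun (b : B) => by
    change ψ (b • (c • x)) = ψ ((b * c) • x)
    rw [mul_smul]

lemma evD_coind {X : Type} [AddCommGroup X] [Module B X] (ψ : X → k) (h1) (h2) (x : X) (b : B) :
    evD k (coind k ψ h1 h2 x) b = ψ (b • x) := rfl

/-- the functional attached to a map into `D(B)` -/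
def toFunctional {X : ModuleCat.{0} B} (f : X →ₗ[B] Dcogen k B) : X →ₗ[k] k where
  toFun x := evD k (f x) 1
  map_add' x y := by rw [map_add, evD_add]
  map_smul' c x := by
    change evD k (f (algebraMap k B c • x)) 1 = c * _
    rw [map_smul, evD_smul, evD_scal]

lemma toFunctional_apply {X : ModuleCat.{0} B} (f : X →ₗ[B] Dcogen k B) (x : X) :
    toFunctional k f x = evD k (f x) 1 := rfl

/-- coinduction from a linear functional -/
def coindL {X : ModuleCat.{0} B} (ψ : X →ₗ[k] k) : X →ₗ[B] Dcogen k B :=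
  coind k ψ ψ.map_add (fun c x => ψ.map_smul c x)

lemma evD_coindL {X : ModuleCat.{0} B} (ψ : X →ₗ[k] k) (x : X) (b : B) :
    evD k (coindL k ψ x) b = ψ (b • x) := rfl

lemma Dcogen_ext {X Y : ModuleCat.{0} B} (i : X →ₗ[B] Y) (hi : Function.Injective i)
    (g : X →ₗ[B] Dcogen k B) : ∃ h : Y →ₗ[B] Dcogen k B, ∀ x, h (i x) = g x := by
  obtain ⟨l, hl⟩ := (i.restrictScalars k).exists_leftInverse_of_injective
    (LinearMap.ker_eq_bot.2 hi)
  refine ⟨coindL k (toFunctional k g ∘ₗ l), fun x => evD_ext k fun b => ?_⟩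
  rw [evD_coindL, ← map_smul, LinearMap.comp_apply]
  have h : l (i (b • x)) = b • x := LinearMap.congr_fun hl (b • x)
  rw [h, toFunctional_apply, map_smul, evD_smul, one_mul]

instance Dcogen_inj : Module.Injective B (Dcogen k B) := by
  constructor
  intro X Y _ _ _ _ i hi g
  exact Dcogen_ext k (X := ModuleCat.of B X) (Y := ModuleCat.of B Y) i hi g

instance Dcogen_fin [FiniteDimensional k B] : Module.Finite B (Dcogen k B) := by
  have hk : Module.Finite k (B →ₗ[k] k) := inferInstance
  obtain ⟨S, hS⟩ := hk.fg_top
  classical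
  let c : (B →ₗ[k] k) → Dcogen k B := fun φ =>
    coind k φ φ.map_add (fun c b => by
      rw [smul_eq_mul, ← Algebra.smul_def, map_smul, smul_eq_mul]) 1
  have hc : ∀ φ (b : B), evD k (c φ) b = φ b := by
    intro φ b
    exact congrArg φ (mul_one b)
  refine ⟨⟨S.image c, ?_⟩⟩
  rw [eq_top_iff]
  intro x _
  let x' : B →ₗ[k] k :=
    { toFun := evD k x
      map_add' := evD_add_right k x
      map_smul' := fun c b => by
        rw [Algebra.smul_def, Algebra.commutes, evD_scal]; rfl }
  have hx : c x' = x := evD_ext k fun b => hc x' b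
  have hall : ∀ φ ∈ Submodule.span k (S : Set (B →ₗ[k] k)),
      c φ ∈ Submodule.span B (S.image c : Set (Dcogen k B)) := by
    intro φ hφ
    induction hφ using Submodule.span_induction with
    | mem φ h =>
      exact Submodule.subset_span (by
        rw [Finset.coe_image]; exact ⟨φ, h, rfl⟩)
    | zero =>
      have : c 0 = 0 := evD_ext k fun b => hc 0 b
      rw [this]; exact zero_mem _
    | add φ ψ _ _ h1 h2 =>
      have : c (φ + ψ) = c φ + c ψ := evD_ext k fun b => by
        rw [evD_add, hc, hc, hc]; rfl
      rw [this]; exact add_mem h1 h2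
    | smul a φ _ h =>
      have : c (a • φ) = algebraMap k B a • c φ := evD_ext k fun (b : B) => by
        rw [evD_smul, evD_scal, hc, hc]; rfl
      rw [this]; exact Submodule.smul_mem _ _ h
  rw [← hx]
  exact hall x' (by rw [hS]; trivial)

lemma exists_embed [FiniteDimensional k B] (C : ModuleCat.{0} B) [Module.Finite B C] :
    ∃ (r : ℕ) (ι : C →ₗ[B] (Fin r → Dcogen k B)), Function.Injective ι := by
  have : Module.Finite k C := Module.Finite.trans B C
  let b := Module.finBasis k (Module.Dual k C)
  refine ⟨_, LinearMap.pi fun j => coindL k (b j), ?_⟩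
  rw [injective_iff_map_eq_zero]
  intro x hx
  rw [← Module.forall_dual_apply_eq_zero_iff k]
  intro φ
  have hj : ∀ j, b j x = 0 := fun j => by
    have h : coindL k (b j) x = 0 := congrFun hx j
    have h2 := evD_coindL k (b j) x 1
    rw [h, one_smul, evD_zero] at h2
    exact h2.symm
  rw [← b.sum_repr φ, LinearMap.sum_apply]
  exact Finset.sum_eq_zero fun j _ => by rw [LinearMap.smul_apply, hj, smul_zero]

end Dual
end P10

namespace P10
open Paper CategoryTheory CategoryTheory.Abelian

noncomputable section Theta
variable (k : Type) [Field k] {A : Type} [Ring A] [Algebra k A] (Q : ModuleCat.{0} A)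

lemma toD_sum_right {B : Type} [Ring B] [Algebra k B] {Y : ModuleCat.{0} Bᵐᵒᵖ}
    (φ : Dunop k B Y) {ι : Type} (s : Finset ι) (y : ι → Y) :
    toD k φ (∑ i ∈ s, y i) = ∑ i ∈ s, toD k φ (y i) := map_sum (toD k φ) y s

/-- `Hom_A(Q, X)` as a right module over the endomorphism ring -/
abbrev HQ (X : ModuleCat.{0} A) : ModuleCat.{0} (Module.End A Q)ᵐᵒᵖ :=
  ModuleCat.of (Module.End A Q)ᵐᵒᵖ (Q →ₗ[A] X)

/-- `D Hom_A(Q, X)` -/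
abbrev TT (X : ModuleCat.{0} A) : ModuleCat.{0} (Module.End A Q) :=
  Dunop k (Module.End A Q) (HQ Q X)

/-- postcomposition -/
def post {X X' : ModuleCat.{0} A} (g : X →ₗ[A] X') : HQ Q X →ₗ[(Module.End A Q)ᵐᵒᵖ] HQ Q X' where
  toFun (f : Q →ₗ[A] X) := g ∘ₗ f
  map_add' (f f' : Q →ₗ[A] X) := LinearMap.comp_add f f' g
  map_smul' _ _ := rfl

lemma post_apply {X X' : ModuleCat.{0} A} (g : X →ₗ[A] X') (f : Q →ₗ[A] X) :
    post Q g f = g ∘ₗ f := rfl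

/-- functoriality -/
def TTmap {X X' : ModuleCat.{0} A} (g : X →ₗ[A] X') : TT k Q X' →ₗ[Module.End A Q] TT k Q X :=
  Dmap k (post Q g)

lemma toD_TTmap {X X' : ModuleCat.{0} A} (g : X →ₗ[A] X') (t : TT k Q X') (f : Q →ₗ[A] X) :
    toD (Y := HQ Q X) k (TTmap k Q g t) f = toD (Y := HQ Q X') k t (g ∘ₗ f) := rfl

lemma TT_ext {X : ModuleCat.{0} A} {s t : TT k Q X}
    (h : ∀ f : Q →ₗ[A] X, toD (Y := HQ Q X) k s f = toD (Y := HQ Q X) k t f) : s = t :=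
  D_ext k h

lemma algE_apply (c : k) (q : Q) : (algebraMap k (Module.End A Q) c) q = algebraMap k A c • q := rfl

lemma opE_smul {X : ModuleCat.{0} A} (e : Module.End A Q) (f : Q →ₗ[A] X) (q : Q) :
    (show Q →ₗ[A] X from (op e • f)) q = f (e q) := rfl

/-- evaluation -/
def Th (q : Q) : TT k Q (Dcogen k A) :=
  mkD (Y := HQ Q (Dcogen k A)) k (fun (f : Q →ₗ[A] Dcogen k A) => evD k (f q) 1)
    (fun (f g : Q →ₗ[A] Dcogen k A) => evD_add k (f q) (g q) 1)
    (fun c (f : Q →ₗ[A] Dcogen k A) => by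
      change evD k (f (algebraMap k A c • q)) 1 = c * evD k (f q) 1
      rw [map_smul, evD_smul, evD_scal])

lemma toD_Th (q : Q) (f : Q →ₗ[A] Dcogen k A) :
    toD (Y := HQ Q (Dcogen k A)) k (Th k Q q) f = evD k (f q) 1 := rfl

/-- evaluation as a linear map -/
def Thl : (ModuleCat.of (Module.End A Q) Q) →ₗ[Module.End A Q] TT k Q (Dcogen k A) where
  toFun q := Th k Q q
  map_add' (q q' : Q) := TT_ext k Q fun f => by
    change evD k (f (q + q')) 1 = evD k (f q) 1 + evD k (f q') 1
    rw [map_add, evD_add]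
  map_smul' _ _ := rfl

lemma Thl_bij [FiniteDimensional k A] [Module.Finite A Q] : Function.Bijective (Thl k Q) := by
  have hfin : Module.Finite k Q := Module.Finite.trans A Q
  constructor
  · rw [injective_iff_map_eq_zero]
    intro (q : Q) hq
    refine (Module.forall_dual_apply_eq_zero_iff k q).1 fun ψ => ?_
    have h : toD (Y := HQ Q (Dcogen k A)) k (Th k Q q) (coindL k ψ) = 0 := by
      change toD (Y := HQ Q (Dcogen k A)) k (Thl k Q q) (coindL k ψ) = 0
      rw [hq]; rfl
    rw [toD_Th, evD_coindL, one_smul] at h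
    exact h
  · intro t
    let F : Module.Dual k (Module.Dual k Q) :=
      { toFun := fun ψ => toD (Y := HQ Q (Dcogen k A)) k t (coindL k ψ)
        map_add' := fun ψ ψ' => toD_add_right (Y := HQ Q (Dcogen k A)) k t (coindL k ψ) (coindL k ψ')
        map_smul' := fun c ψ => by
          refine Eq.trans ?_ (toD_scal (Y := HQ Q (Dcogen k A)) k c t (coindL k ψ))
          refine congrArg (toD (Y := HQ Q (Dcogen k A)) k t) ?_
          refine LinearMap.ext fun (q : Q) => evD_ext k fun b => ?_
          change c * ψ (b • q) = ψ (b • (algebraMap k A c • q))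
          rw [← mul_smul, ← Algebra.commutes, mul_smul]
          exact (ψ.map_smul c _).symm }
    obtain ⟨q, hq⟩ := (Module.evalEquiv k Q).surjective F
    refine ⟨q, TT_ext k Q fun f => ?_⟩
    change evD k (f q) 1 = _
    have h1 := LinearMap.congr_fun hq (toFunctional k f)
    change evD k (f q) 1 = toD (Y := HQ Q (Dcogen k A)) k t (coindL k (toFunctional k f)) at h1
    rw [h1]
    refine congrArg (toD (Y := HQ Q (Dcogen k A)) k t) ?_
    refine LinearMap.ext fun (q : Q) => evD_ext k fun b => ?_
    change evD k (f (b • q)) 1 = evD k (f q) b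
    rw [map_smul, evD_smul, one_mul]

lemma TT_add [FiniteDimensional k A] [Module.Finite A Q] {I : ModuleCat.{0} A}
    (h : InAdd A (Dcogen k A) I) :
    InAdd (Module.End A Q) (ModuleCat.of (Module.End A Q) Q) (TT k Q I) := by
  classical
  obtain ⟨m, s, r, hrs⟩ := h
  let e := LinearEquiv.ofBijective (Thl k Q) (Thl_bij k Q)
  let u : ∀ j : Fin m, Dcogen k A →ₗ[A] I := fun j =>
    r ∘ₗ LinearMap.single A (fun _ : Fin m => (Dcogen k A : Type)) j
  let v : ∀ j : Fin m, I →ₗ[A] Dcogen k A := fun j => LinearMap.proj j ∘ₗ s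
  refine ⟨m, LinearMap.pi fun j => e.symm.toLinearMap ∘ₗ TTmap k Q (u j),
    ∑ j, TTmap k Q (v j) ∘ₗ e.toLinearMap ∘ₗ LinearMap.proj j, ?_⟩
  refine LinearMap.ext fun t => ?_
  have h1 : (∑ j, TTmap k Q (v j) ∘ₗ e.toLinearMap ∘ₗ
      LinearMap.proj (φ := fun _ : Fin m => (ModuleCat.of (Module.End A Q) Q : Type)) j)
      (LinearMap.pi (fun j => e.symm.toLinearMap ∘ₗ TTmap k Q (u j)) t)
      = ∑ j, TTmap k Q (v j) (TTmap k Q (u j) t) := by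
    rw [LinearMap.sum_apply]
    refine Finset.sum_congr rfl fun j _ => ?_
    change TTmap k Q (v j) (e (e.symm (TTmap k Q (u j) t))) = _
    rw [e.apply_symm_apply]
  rw [LinearMap.comp_apply, h1]
  refine TT_ext k Q fun f => ?_
  rw [toD_sum]
  have h2 : ∑ j, toD (Y := HQ Q I) k (TTmap k Q (v j) (TTmap k Q (u j) t)) f =
      ∑ j, toD (Y := HQ Q I) k t (u j ∘ₗ v j ∘ₗ f) := rfl
  rw [h2]
  refine (toD_sum_right (Y := HQ Q I) k t Finset.univ (fun j => u j ∘ₗ v j ∘ₗ f)).symm.trans ?_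
  refine congrArg (toD (Y := HQ Q I) k t) ?_
  change (∑ j, u j ∘ₗ v j ∘ₗ f : Q →ₗ[A] I) = f
  refine LinearMap.ext fun q => ?_
  rw [LinearMap.sum_apply]
  have h3 : ∑ j, (u j ∘ₗ v j ∘ₗ f) q = r (∑ j, Pi.single j (s (f q) j)) := by
    rw [map_sum]; rfl
  rw [h3, Finset.univ_sum_single]
  exact LinearMap.congr_fun hrs (f q)

end Theta
end P10

namespace P10
open Paper CategoryTheory CategoryTheory.Abelian

noncomputable section Main
variable (k : Type) [Field k] {A : Type} [Ring A] [Algebra k A] [FiniteDimensional k A]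
  (Q : ModuleCat.{0} A) [Module.Finite A Q]

lemma pow_add {B : Type} [Ring B] (D : ModuleCat.{0} B) (r : ℕ) :
    InAdd B D (ModuleCat.of B (Fin r → D)) :=
  ⟨r, LinearMap.id, LinearMap.id, rfl⟩

lemma main_ind (N : ℕ) (hEQ : ∀ i, 1 ≤ i → i ≤ N → EV (Module.End A Q) Q Q i) (m : ℕ) :
    m ≤ N → ∀ C : ModuleCat.{0} A, Module.Finite A C → (∀ i, 1 ≤ i → EV A Q C i) →
    (∀ (W : Type) [AddCommGroup W] [Module A W] (i : ℕ), m < i → EV A W C i) →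
    ResLE (Module.End A Q) (ModuleCat.of (Module.End A Q) Q)
      (InAdd (Module.End A Q) (ModuleCat.of (Module.End A Q) Q)) (TT k Q C) m ∧
    ∀ i, 1 ≤ i → i + m ≤ N → EV (Module.End A Q) Q (TT k Q C) i := by
  induction m with
  | zero =>
    intro _ C hC _ hid
    obtain ⟨r, ι, hι⟩ := exists_embed k C
    have hex : Function.Exact ι (LinearMap.range ι).mkQ := by
      rw [LinearMap.exact_iff, Submodule.ker_mkQ]
    obtain ⟨ψ, hψ⟩ := EV_extend hex hι (Submodule.mkQ_surjective _)
      (hid ((Fin r → Dcogen k A) ⧸ LinearMap.range ι) 1 (by omega)) LinearMap.id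
    have hadd : InAdd A (Dcogen k A) C := ⟨r, ι, ψ, hψ⟩
    have h2 := TT_add k Q hadd
    exact ⟨ResLE_zero h2, fun i h1 hi => EV_add h2 i (hEQ i h1 (by omega))⟩
  | succ m ih =>
    intro hmN C hC hQC hid
    obtain ⟨r, ι, hι⟩ := exists_embed k C
    let I : ModuleCat.{0} A := ModuleCat.of A (Fin r → Dcogen k A)
    let ι' : C →ₗ[A] I := ι
    let C' : ModuleCat.{0} A := ModuleCat.of A (I ⧸ LinearMap.range ι')
    let p : I →ₗ[A] C' := (LinearMap.range ι').mkQ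
    have hp : Function.Surjective p := Submodule.mkQ_surjective _
    have hex : Function.Exact ι' p := by
      rw [LinearMap.exact_iff]; exact Submodule.ker_mkQ _
    have hIadd : InAdd A (Dcogen k A) I := pow_add _ r
    have hI : ∀ (W : Type) [AddCommGroup W] [Module A W] (i : ℕ), 1 ≤ i → EV A W I i :=
      fun W _ _ i hi => EV_add hIadd i (EV_inj i hi)
    have hC'fin : Module.Finite A C' := by
      have : Module.Finite A I := inferInstanceAs (Module.Finite A (Fin r → Dcogen k A))
      exact Module.Finite.of_surjective p hp
    obtain ⟨hR, hE⟩ := ih (by omega) C' hC'fin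
      (fun i hi => EV_third_co hex hι hp i (hI Q i hi) (hQC (i+1) (by omega)))
      (fun W _ _ i hi => EV_third_co hex hι hp i (hI W i (by omega)) (hid W (i+1) (by omega)))
    have hpi : Function.Injective (post Q ι') := by
      intro (f : Q →ₗ[A] C) (g : Q →ₗ[A] C) hfg
      exact LinearMap.ext fun q => hι (LinearMap.congr_fun (show ι' ∘ₗ f = ι' ∘ₗ g from hfg) q)
    have hps : Function.Surjective (post Q p) := by
      intro (f : Q →ₗ[A] C')
      exact EV_lift hex hι hp (hQC 1 le_rfl) f
    have hpe : Function.Exact (post Q ι') (post Q p) := by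
      intro (f : Q →ₗ[A] I)
      constructor
      · intro hf
        have hmem : ∀ x, f x ∈ LinearMap.range ι' := fun x =>
          (hex _).1 (LinearMap.congr_fun (show p ∘ₗ f = 0 from hf) x)
        let e := LinearEquiv.ofInjective ι' hι
        refine ⟨e.symm.toLinearMap ∘ₗ f.codRestrict _ hmem, LinearMap.ext fun x => ?_⟩
        exact congrArg Subtype.val (e.apply_symm_apply ⟨f x, hmem x⟩)
      · rintro ⟨g, rfl⟩
        exact LinearMap.ext fun x => (hex _).2 ⟨_, rfl⟩
    have hf : Function.Injective (TTmap k Q p) := Dmap_inj k hps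
    have hg : Function.Surjective (TTmap k Q ι') := Dmap_surj k hpi
    have hfg : Function.Exact (TTmap k Q p) (TTmap k Q ι') := Dmap_exact k hpe
    have hIQ := TT_add k Q hIadd
    refine ⟨ResLE_splice hIQ hf hg hfg (fun φ => EV_lift hfg hf hg (hE 1 le_rfl (by omega)) φ) hR,
      fun i h1 hi => EV_third_co hfg hf hg i (EV_add hIQ i (hEQ i h1 (by omega)))
        (hE (i+1) (by omega) (by omega))⟩

/-- `Hom_E(Z, Q)` as an `A`-module -/
def HZ (Z : ModuleCat.{0} (Module.End A Q)) : ModuleCat.{0} A :=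
  ModuleCat.of A (Z →ₗ[Module.End A Q] Q)

/-- `Hom_E(Z, E) ≅ Hom_A(Q, Hom_E(Z, Q))` -/
def swapEquiv (Z : ModuleCat.{0} (Module.End A Q)) :
    (ModuleCat.of (Module.End A Q)ᵐᵒᵖ (Z →ₗ[Module.End A Q] Module.End A Q))
      ≃ₗ[(Module.End A Q)ᵐᵒᵖ] HQ Q (HZ Q Z) where
  toFun (θ : Z →ₗ[Module.End A Q] Module.End A Q) :=
    ({ toFun := fun q =>
        { toFun := fun z => θ z q
          map_add' := fun x y => by rw [map_add]; rfl
          map_smul' := fun e x => by rw [map_smul]; rfl }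
       map_add' := fun x y => LinearMap.ext fun z => (θ z).map_add x y
       map_smul' := fun a x => LinearMap.ext fun z => (θ z).map_smul a x } :
      Q →ₗ[A] (Z →ₗ[Module.End A Q] Q))
  map_add' _ _ := rfl
  map_smul' _ _ := rfl
  invFun (f : Q →ₗ[A] (Z →ₗ[Module.End A Q] Q)) :=
    ({ toFun := fun z =>
        { toFun := fun q => f q z
          map_add' := fun x y => by rw [map_add]; rfl
          map_smul' := fun a x => by rw [map_smul]; rfl }
       map_add' := fun x y => LinearMap.ext fun q => (f q).map_add x y
       map_smul' := fun e x => LinearMap.ext fun q => (f q).map_smul e x } :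
      Z →ₗ[Module.End A Q] Module.End A Q)
  left_inv _ := rfl
  right_inv _ := rfl

lemma endFin : Module.Finite k (Module.End A Q) := by
  have hfin : Module.Finite k Q := Module.Finite.trans A Q
  let F : Module.End A Q →ₗ[k] (Q →ₗ[k] Q) :=
    { toFun := fun e => e.restrictScalars k
      map_add' := fun _ _ => rfl
      map_smul' := fun _ _ => rfl }
  refine Module.Finite.of_injective F ?_
  intro e e' h
  exact LinearMap.ext fun q => LinearMap.congr_fun h q

lemma homFin [IsNoetherianRing A] (Z : ModuleCat.{0} (Module.End A Q))
    (hZ : Module.Finite (Module.End A Q) Z) :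
    Module.Finite A (Z →ₗ[Module.End A Q] Q) := by
  obtain ⟨S, hS⟩ := hZ.fg_top
  let F : (Z →ₗ[Module.End A Q] Q) →ₗ[A] (S → Q) :=
    { toFun := fun f s => f s
      map_add' := fun _ _ => rfl
      map_smul' := fun _ _ => rfl }
  refine Module.Finite.of_injective F ?_
  intro f g h
  refine LinearMap.ext_on hS fun z hz => ?_
  exact congrFun h ⟨z, hz⟩

end Main
end P10


noncomputable section Statement10
open Paper

/-- Lemma 3.7: for a relative `n`-Auslander–Gorenstein pair `(A, Q)`
with `pd_A Q ≤ d ≤ n − 2`, `id_A Q ≤ n − d` and `d ≥ 2`, there is an exact sequence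
`0 → Q_{n−d} → ⋯ → Q_0 → ν_Λ Ω^d(Q) → 0` of right `Λ`-modules with terms in `add Q`,
remaining exact under `Hom_Λ(Q, −)` (`Λ = End_A(Q)^op`). -/
theorem stmt10 (k : Type) [Field k] (A : Type) [Ring A] [Algebra k A] [FiniteDimensional k A]
    (Q : ModuleCat.{0} A) [Module.Finite A Q] (n d : ℕ)
    (hpair : IsRelAGPair A Q n) (hpd : pdLE A Q d) (hdn : d ≤ n - 2)
    (hid : idLE A Q (n - d)) (hd2 : 2 ≤ d) :
    ∀ Z : ModuleCat.{0} (Module.End A Q),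
      IsOmegaOf (Module.End A Q) d (ModuleCat.of (Module.End A Q) Q) Z →
      RelAddDimLE (Module.End A Q) (ModuleCat.of (Module.End A Q) Q)
        (nu k (Module.End A Q) Z) (n - d) := by
  intro Z hZ
  obtain ⟨hidA, -, hself, hdom⟩ := hpair
  have hfinE : Module.Finite k (Module.End A Q) := P10.endFin k Q
  have hfinQ : Module.Finite k Q := Module.Finite.trans A Q
  have hNA : IsNoetherianRing A := isNoetherian_of_tower k inferInstance
  have hNE : IsNoetherianRing (Module.End A Q) := isNoetherian_of_tower k inferInstance
  have hQE : Module.Finite (Module.End A Q) Q := Module.Finite.of_restrictScalars_finite k _ _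
  obtain ⟨hEQ, ⟨e⟩⟩ := P10.dom_facts Q n (by omega) hdom
  obtain ⟨hZf, hW⟩ := P10.omega_facts Q d (ModuleCat.of (Module.End A Q) Q) Z hQE
    (fun i h1 hi => hEQ i h1 (by omega)) hZ
  have hC := P10.homFin Q Z hZf
  have h1 := hW Q 1 (fun i hi => P10.EV_of_selfOrth Q hself i hi)
    (fun i hi => P10.EV_iso_right e i (P10.EV_of_pdLE d Q hpd i (by omega)))
  have h2 : ∀ (W : Type) [AddCommGroup W] [Module A W] (i : ℕ), n - d < i →
      P10.EV A W (Z →ₗ[Module.End A Q] Q) i := fun W _ _ i hi =>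
    hW W (n - d + 1) (fun i hi => P10.EV_of_idLE (n - d) Q hid i (by omega))
      (fun i hi => P10.EV_iso_right e i (P10.EV_of_idLE n (ModuleCat.of A A) hidA i (by omega)))
      i hi
  obtain ⟨hR, -⟩ := P10.main_ind k Q (n - 2) hEQ (n - d) (by omega)
    (P10.HZ Q Z) hC h1 h2
  exact P10.ResLE_iso (P10.Dequiv k (P10.swapEquiv Q Z)) hR

end Statement10
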